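/- arXiv:2305.12467 — 16 statements merged into one kernel-verified Lean document; each statement's English description precedes it below -/
import Mathlib

section
/- Let x₁, x₂, y be unit vectors in a real inner product space such that ⟨x₁, x₂⟩ = cos Δ for some Δ ∈ (0, π/2). If ⟨y, x₁⟩ ≥ 0 and ⟨y, x₂⟩ ≤ 0, then 0 ≤ ⟨y, x₁⟩ ≤ sin Δ and −sin Δ ≤ ⟨y, x₂⟩ ≤ 0. -/
open scoped RealInnerProductSpace

lemma aux_bound {E : Type*} [NormedAddCommGroup E] [InnerProductSpace ℝ E]
    (a b y : E) (c s : ℝ) (hc : 0 ≤ c) (hs : 0 ≤ s) (hcs : s ^ 2 + c ^ 2 = 1)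
    (ha : ‖a‖ = 1) (hb : ‖b‖ = 1) (hy : ‖y‖ = 1)
    (hab : inner ℝ a b = c) (h : inner ℝ y b ≤ 0) : inner ℝ y a ≤ s := by
  have h1 : ‖a - c • b‖ ^ 2 = s ^ 2 := by
    rw [norm_sub_sq_real, inner_smul_right, hab, norm_smul, ha, hb, mul_pow,
      Real.norm_eq_abs, sq_abs]
    linarith
  have h2 : ‖a - c • b‖ = s := (sq_eq_sq₀ (norm_nonneg _) hs).mp h1
  have h3 := real_inner_le_norm y (a - c • b)
  rw [h2, hy, inner_sub_right, inner_smul_right] at h3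
  nlinarith [mul_nonneg hc (neg_nonneg.mpr h)]

/-- If `x₁, x₂, y` are unit vectors in a real inner product space with
`⟪x₁, x₂⟫ = cos Δ` for some `Δ ∈ (0, π/2)`, and `⟪y, x₁⟫ ≥ 0`, `⟪y, x₂⟫ ≤ 0`,
then `0 ≤ ⟪y, x₁⟫ ≤ sin Δ` and `-sin Δ ≤ ⟪y, x₂⟫ ≤ 0`. -/
theorem stmt0 {E : Type*} [NormedAddCommGroup E] [InnerProductSpace ℝ E]
    (x₁ x₂ y : E) (Δ : ℝ) (hΔ : Δ ∈ Set.Ioo 0 (Real.pi / 2))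
    (hx₁ : ‖x₁‖ = 1) (hx₂ : ‖x₂‖ = 1) (hy : ‖y‖ = 1)
    (hangle : ⟪x₁, x₂⟫ = Real.cos Δ)
    (h₁ : 0 ≤ ⟪y, x₁⟫) (h₂ : ⟪y, x₂⟫ ≤ 0) :
    (0 ≤ ⟪y, x₁⟫ ∧ ⟪y, x₁⟫ ≤ Real.sin Δ) ∧
    (-Real.sin Δ ≤ ⟪y, x₂⟫ ∧ ⟪y, x₂⟫ ≤ 0) := by
  have hc : 0 ≤ Real.cos Δ :=
    Real.cos_nonneg_of_mem_Icc ⟨by linarith [hΔ.1, hΔ.2], hΔ.2.le⟩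
  have hs : 0 ≤ Real.sin Δ :=
    Real.sin_nonneg_of_nonneg_of_le_pi hΔ.1.le (by linarith [hΔ.1, hΔ.2])
  have hcs := Real.sin_sq_add_cos_sq Δ
  refine ⟨⟨h₁, aux_bound x₁ x₂ y _ _ hc hs hcs hx₁ hx₂ hy hangle h₂⟩, ?_, h₂⟩
  have h := aux_bound x₂ x₁ (-y) _ _ hc hs hcs hx₂ hx₁ (by rw [norm_neg, hy])
    (by rw [real_inner_comm, hangle]) (by rw [inner_neg_left]; linarith)
  rw [inner_neg_left] at h
  linarith
end

section
/- Let x₊, x₋ be unit vectors in a real inner product space with ⟨x₊, x₋⟩ = cos Δ, where Δ ∈ (0, π/2) satisfies cos Δ ≥ 4/5, and let p ≥ 5 be a real number. Define μ := (p·x₊ − x₋)/‖p·x₊ − x₋‖, so ‖p·x₊ − x₋‖ = √(p² + 1 − 2p cos Δ). If w is a unit vector with ⟨w, μ⟩ ≥ 1 − ε for some ε ∈ (0, 1), then −2√ε·sin Δ − ε ≤ ⟨w, x₋⟩ − (p cos Δ − 1)/√(p² + 1 − 2p cos Δ) ≤ 2√ε·sin Δ. -/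
open scoped RealInnerProductSpace

set_option maxHeartbeats 1000000 in
/-- If `w` is a unit vector with `⟪w, μ⟫ ≥ 1 - ε`, where `μ` is the normalized
direction of `p • x₊ - x₋`, then `⟪w, x₋⟫` is within `2√ε sin Δ` (resp. `2√ε sin Δ + ε`)
of `(p cos Δ - 1)/√(p² + 1 - 2p cos Δ)`. -/
theorem stmt2 {E : Type*} [NormedAddCommGroup E] [InnerProductSpace ℝ E]
    (xp xm w : E) (Δ p ε : ℝ) (hΔ : Δ ∈ Set.Ioo 0 (Real.pi / 2))
    (hcosΔ : 4 / 5 ≤ Real.cos Δ)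
    (hxp : ‖xp‖ = 1) (hxm : ‖xm‖ = 1) (hw : ‖w‖ = 1)
    (hangle : ⟪xp, xm⟫ = Real.cos Δ) (hp : 5 ≤ p)
    (hε : ε ∈ Set.Ioo (0 : ℝ) 1)
    (hwμ : 1 - ε ≤ ⟪w, ‖p • xp - xm‖⁻¹ • (p • xp - xm)⟫) :
    -2 * Real.sqrt ε * Real.sin Δ - ε ≤
      ⟪w, xm⟫ - (p * Real.cos Δ - 1) / Real.sqrt (p ^ 2 + 1 - 2 * p * Real.cos Δ) ∧
    ⟪w, xm⟫ - (p * Real.cos Δ - 1) / Real.sqrt (p ^ 2 + 1 - 2 * p * Real.cos Δ) ≤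
      2 * Real.sqrt ε * Real.sin Δ := by
  have hs : 0 < Real.sin Δ := Real.sin_pos_of_pos_of_lt_pi hΔ.1 (by linarith [hΔ.2, Real.pi_pos])
  have hsc := Real.sin_sq_add_cos_sq Δ
  have hc1 := Real.cos_le_one Δ
  have hN2 : ‖p • xp - xm‖ ^ 2 = p ^ 2 + 1 - 2 * p * Real.cos Δ := by
    rw [@norm_sub_sq_real, norm_smul, real_inner_smul_left, hangle, hxp, hxm, mul_pow,
      Real.norm_eq_abs, sq_abs]
    ring
  have hNhalf : p ^ 2 ≤ 2 * ‖p • xp - xm‖ ^ 2 := by rw [hN2]; nlinarith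
  have hsqrt : Real.sqrt (p ^ 2 + 1 - 2 * p * Real.cos Δ) = ‖p • xp - xm‖ := by
    rw [← hN2, Real.sqrt_sq (norm_nonneg _)]
  have hC : ⟪p • xp - xm, xm⟫ = p * Real.cos Δ - 1 := by
    rw [inner_sub_left, real_inner_smul_left, hangle, real_inner_self_eq_norm_sq, hxm]
    ring
  rw [hsqrt]
  have hNpos : 0 < ‖p • xp - xm‖ := by
    rcases (norm_nonneg (p • xp - xm)).lt_or_eq with h | h
    · exact h
    · rw [← h] at hNhalf; nlinarith
  have hmu : ‖‖p • xp - xm‖⁻¹ • (p • xp - xm)‖ = 1 := by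
    rw [norm_smul, norm_inv, norm_norm, inv_mul_cancel₀ hNpos.ne']
  have hcdef : ⟪‖p • xp - xm‖⁻¹ • (p • xp - xm), xm⟫
      = (p * Real.cos Δ - 1) / ‖p • xp - xm‖ := by
    rw [real_inner_smul_left, hC]; ring
  have hc0 : 0 ≤ (p * Real.cos Δ - 1) / ‖p • xp - xm‖ := by
    apply div_nonneg _ hNpos.le
    nlinarith
  have hcs : 1 - ((p * Real.cos Δ - 1) / ‖p • xp - xm‖) ^ 2 ≤ 2 * Real.sin Δ ^ 2 := by
    have h1 : 1 - ((p * Real.cos Δ - 1) / ‖p • xp - xm‖) ^ 2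
        = (p ^ 2 * Real.sin Δ ^ 2) / ‖p • xp - xm‖ ^ 2 := by
      rw [div_pow, eq_div_iff (by positivity), sub_mul, div_mul_cancel₀ _ (by positivity), hN2]
      linear_combination (-p ^ 2) * hsc
    rw [h1, div_le_iff₀ (by positivity)]
    nlinarith [sq_nonneg (Real.sin Δ)]
  generalize (p * Real.cos Δ - 1) / ‖p • xp - xm‖ = c at *
  generalize ‖p • xp - xm‖⁻¹ • (p • xp - xm) = m at *
  have ha1 : ⟪w, m⟫ ≤ 1 := by
    have := real_inner_le_norm w m
    rwa [hw, hmu, one_mul] at this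
  have hcle : c ≤ 1 := by
    have := real_inner_le_norm m xm
    rwa [hmu, hxm, one_mul, hcdef] at this
  have hCS := real_inner_mul_inner_self_le (w - ⟪w, m⟫ • m) (xm - c • m)
  have hww : ⟪w, w⟫ = 1 := by rw [real_inner_self_eq_norm_sq, hw]; norm_num
  have hmm : ⟪m, m⟫ = 1 := by rw [real_inner_self_eq_norm_sq, hmu]; norm_num
  have hxx : ⟪xm, xm⟫ = 1 := by rw [real_inner_self_eq_norm_sq, hxm]; norm_num
  have hcdef' : ⟪xm, m⟫ = c := by rw [real_inner_comm, hcdef]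
  have hmw : ⟪m, w⟫ = ⟪w, m⟫ := real_inner_comm _ _
  simp only [inner_sub_left, inner_sub_right, real_inner_smul_left, real_inner_smul_right,
    hww, hmm, hxx, hcdef, hcdef', hmw] at hCS
  generalize ⟪w, m⟫ = a at *
  generalize ⟪w, xm⟫ = b at *
  have hε0 := hε.1
  have hε1 := hε.2
  have hkey : (b - a * c) ^ 2 ≤ (2 * Real.sqrt ε * Real.sin Δ) ^ 2 := by
    have h1 : (b - a * c) ^ 2 ≤ (1 - a ^ 2) * (1 - c ^ 2) := by nlinarith
    have h2 : (2 * Real.sqrt ε * Real.sin Δ) ^ 2 = (2 * ε) * (2 * Real.sin Δ ^ 2) := by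
      rw [mul_pow, mul_pow, Real.sq_sqrt hε0.le]; ring
    rw [h2]
    refine h1.trans (mul_le_mul ?_ hcs ?_ ?_)
    · nlinarith [sq_nonneg (1 - a)]
    · nlinarith [mul_nonneg (sub_nonneg.2 hcle) hc0]
    · linarith
  have hr : 0 ≤ 2 * Real.sqrt ε * Real.sin Δ := by positivity
  have habs := abs_le.1 (abs_le_of_sq_le_sq hkey hr)
  have hd : (1 - a) * c ≤ ε := by
    have := mul_le_mul_of_nonneg_left hcle (sub_nonneg.2 ha1)
    linarith
  have hd0 : 0 ≤ (1 - a) * c := mul_nonneg (by linarith) hc0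
  constructor
  · linarith [habs.1]
  · linarith [habs.2]
end

section
/- Let a > 0 and c ∈ [0, 1/20]. Suppose U : [0, ∞) → ℝ is differentiable with U(0) ≥ −1/6 and satisfies the differential inequality U′(t) ≥ (2/(3(a + 1.1·t)))·(1 − c − U(t)²) for all t ≥ 0. Then for all t ≥ 0, U(t) ≥ (1 − c)·(1 − 2/(1 + 0.7·(1 + 1.1·t/a)^{1.15})). -/
/-- Scalar comparison estimate for Phase I condensation: if `U` satisfies
`U(0) ≥ -1/6` and `U'(t) ≥ (2/(3(a + 1.1t)))(1 - c - U(t)²)` for all `t ≥ 0`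
with `a > 0` and `c ∈ [0, 1/20]`, then
`U(t) ≥ (1-c)(1 - 2/(1 + 0.7(1 + 1.1t/a)^{1.15}))` for all `t ≥ 0`. -/
theorem stmt6 (a c : ℝ) (ha : 0 < a) (hc : c ∈ Set.Icc (0 : ℝ) (1 / 20))
    (U U' : ℝ → ℝ)
    (hderiv : ∀ t, 0 ≤ t → HasDerivAt U (U' t) t)
    (hU0 : -(1 / 6) ≤ U 0)
    (hineq : ∀ t, 0 ≤ t → 2 / (3 * (a + 1.1 * t)) * (1 - c - (U t) ^ 2) ≤ U' t) :
    ∀ t, 0 ≤ t →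
      (1 - c) * (1 - 2 / (1 + 0.7 * (1 + 1.1 * t / a) ^ (1.15 : ℝ))) ≤ U t := by
  obtain ⟨hc0, hc1⟩ := hc
  have key : ∀ t, 0 ≤ t → HasDerivAt
      (fun t : ℝ => (1 - c) * (1 - 2 / (1 + 0.7 * (1 + 1.1 * t / a) ^ (1.15 : ℝ))))
      ((1 - c) * (2 * (0.7 * (1.265 * (1 + 1.1 * t / a) ^ (1.15 : ℝ) / (a + 1.1 * t))) /
        (1 + 0.7 * (1 + 1.1 * t / a) ^ (1.15 : ℝ)) ^ 2)) t := by
    intro t ht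
    have hs : 0 < 1 + 1.1 * t / a := by positivity
    have h1 : HasDerivAt (fun t : ℝ => 1 + 1.1 * t / a) (1.1 * 1 / a) t :=
      (((hasDerivAt_id t).const_mul 1.1).div_const a).const_add 1
    have h2 := h1.rpow_const (p := 1.15) (Or.inl hs.ne')
    have hz : 0 < (1 + 1.1 * t / a) ^ (1.15 : ℝ) := Real.rpow_pos_of_pos hs _
    have h3 := (h2.const_mul 0.7).const_add 1
    have hne : (1 + 0.7 * (1 + 1.1 * t / a) ^ (1.15 : ℝ)) ≠ 0 := by positivity
    have h4 := (((hasDerivAt_const t (2 : ℝ)).div h3 hne).const_sub 1).const_mul (1 - c)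
    refine h4.congr_deriv ?_
    rw [Real.rpow_sub hs, Real.rpow_one]
    have e : 1 + 1.1 * t / a = (a + 1.1 * t) / a := by field_simp
    have hpos : 0 < a + 1.1 * t := by positivity
    generalize (1 + 1.1 * t / a) ^ (1.15 : ℝ) = z at *
    rw [e]
    field_simp
    ring
  intro t ht
  refine image_le_of_deriv_right_lt_deriv_boundary' (a := 0) (b := t)
    (f := fun t : ℝ => (1 - c) * (1 - 2 / (1 + 0.7 * (1 + 1.1 * t / a) ^ (1.15 : ℝ))))
    (B := U) (B' := U')
    (fun x hx => (key x hx.1).continuousAt.continuousWithinAt)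
    (fun x hx => (key x hx.1).hasDerivWithinAt) ?_
    (fun x hx => (hderiv x hx.1).continuousAt.continuousWithinAt)
    (fun x hx => (hderiv x hx.1).hasDerivWithinAt) ?_ ⟨ht, le_refl t⟩
  · norm_num
    linarith
  · intro x hx hxU
    refine lt_of_lt_of_le ?_ (hineq x hx.1)
    have hx0 := hx.1
    rw [← hxU]
    have hs : 0 < 1 + 1.1 * x / a := by positivity
    have hz : 0 < (1 + 1.1 * x / a) ^ (1.15 : ℝ) := Real.rpow_pos_of_pos hs _
    have hpos : 0 < a + 1.1 * x := by positivity
    generalize (1 + 1.1 * x / a) ^ (1.15 : ℝ) = z at *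
    rw [← sub_pos]
    have e : 2 / (3 * (a + 1.1 * x)) * (1 - c - ((1 - c) * (1 - 2 / (1 + 0.7 * z))) ^ 2) -
        (1 - c) * (2 * (0.7 * (1.265 * z / (a + 1.1 * x))) / (1 + 0.7 * z) ^ 2) =
        (1 - c) * ((2 * (4 * 0.7 * z + c * (0.7 * z - 1) ^ 2) - 3 * 2 * 0.7 * 1.265 * z)) /
        (3 * (a + 1.1 * x) * (1 + 0.7 * z) ^ 2) := by
      field_simp
      ring
    rw [e]
    have h1c : 0 < 1 - c := by linarith
    have h2 : 0 < 2 * (4 * 0.7 * z + c * (0.7 * z - 1) ^ 2) - 3 * 2 * 0.7 * 1.265 * z := by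
      have := mul_nonneg hc0 (sq_nonneg (0.7 * z - 1))
      linarith
    positivity
end

section
/- Let Δ ∈ (0, π/2) and ε ≥ 0. Suppose U, V : [0, ∞) → ℝ are differentiable and satisfy the ODE system U′(t) = U(t)V(t)·cos Δ − U(t)² and V′(t) = U(t)V(t)·cos Δ − (1+ε)·V(t)² for all t ≥ 0, with initial condition U(0) > V(0) > 0. Then for every t ≥ 0 one has U(t) > V(t) > 0, and the sum U + V is strictly decreasing on [0, ∞); in particular U(t) + V(t) ≤ U(0) + V(0) for all t ≥ 0. -/
theorem pos_of_deriv_ge (W W' a : ℝ → ℝ) (hW : ∀ t, 0 ≤ t → HasDerivAt W (W' t) t)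
    (ha : ContinuousOn a (Set.Ici 0)) (h : ∀ t, 0 ≤ t → a t * W t ≤ W' t) (h0 : 0 < W 0) :
    ∀ t, 0 ≤ t → 0 < W t := by
  have hb : Continuous (fun s => a (max s 0)) :=
    ha.comp_continuous (by fun_prop) (fun s => le_max_right s 0)
  set A : ℝ → ℝ := fun t => ∫ s in (0:ℝ)..t, a (max s 0) with hA
  have hAd : ∀ t, HasDerivAt A (a (max t 0)) t := fun t =>
    hb.integral_hasStrictDerivAt 0 t |>.hasDerivAt
  have hd : ∀ t, 0 ≤ t → HasDerivAt (fun t => W t * Real.exp (-A t))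
      (W' t * Real.exp (-A t) + W t * (Real.exp (-A t) * (-a (max t 0)))) t := fun t ht =>
    (hW t ht).mul ((hAd t).neg.exp)
  have hm : MonotoneOn (fun t => W t * Real.exp (-A t)) (Set.Ici 0) := by
    apply monotoneOn_of_deriv_nonneg (convex_Ici 0)
    · exact fun t ht => (hd t ht).continuousAt.continuousWithinAt
    · intro t ht
      rw [interior_Ici] at ht
      exact (hd t (le_of_lt ht)).differentiableAt.differentiableWithinAt
    · intro t ht
      rw [interior_Ici] at ht
      have ht' : 0 ≤ t := le_of_lt ht
      rw [(hd t ht').deriv, max_eq_left ht']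
      have := mul_nonneg (sub_nonneg.2 (h t ht')) (Real.exp_pos (-A t)).le
      linarith
  intro t ht
  have h1 := hm (Set.mem_Ici.2 le_rfl) (Set.mem_Ici.2 ht) ht
  have h2 : 0 < W 0 * Real.exp (-A 0) := mul_pos h0 (Real.exp_pos _)
  exact pos_of_mul_pos_left (lt_of_lt_of_le h2 h1) (Real.exp_pos _).le

/-- For the Phase II system `U' = UV cos Δ - U²`, `V' = UV cos Δ - (1+ε)V²` with
`U(0) > V(0) > 0`, one has `U(t) > V(t) > 0` for all `t ≥ 0`, the sum `U + V` is
strictly decreasing on `[0, ∞)`, and in particular `U(t) + V(t) ≤ U(0) + V(0)`. -/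
theorem stmt7 (Δ ε : ℝ) (hΔ : Δ ∈ Set.Ioo 0 (Real.pi / 2)) (hε : 0 ≤ ε)
    (U V : ℝ → ℝ)
    (hU : ∀ t, 0 ≤ t → HasDerivAt U (U t * V t * Real.cos Δ - (U t) ^ 2) t)
    (hV : ∀ t, 0 ≤ t → HasDerivAt V (U t * V t * Real.cos Δ - (1 + ε) * (V t) ^ 2) t)
    (hUV0 : U 0 > V 0) (hV0 : V 0 > 0) :
    (∀ t, 0 ≤ t → U t > V t ∧ V t > 0) ∧
    StrictAntiOn (fun t => U t + V t) (Set.Ici 0) ∧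
    (∀ t, 0 ≤ t → U t + V t ≤ U 0 + V 0) := by
  have cU : ContinuousOn U (Set.Ici 0) := fun t ht => (hU t ht).continuousAt.continuousWithinAt
  have cV : ContinuousOn V (Set.Ici 0) := fun t ht => (hV t ht).continuousAt.continuousWithinAt
  have pV : ∀ t, 0 ≤ t → 0 < V t :=
    pos_of_deriv_ge V _ (fun t => U t * Real.cos Δ - (1 + ε) * V t) hV (by fun_prop)
      (fun t _ => le_of_eq (by ring)) hV0
  have pW : ∀ t, 0 ≤ t → 0 < U t - V t :=
    pos_of_deriv_ge (fun t => U t - V t) _ (fun t => -(U t + V t))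
      (fun t ht => (hU t ht).sub (hV t ht)) (by fun_prop)
      (fun t _ => by nlinarith [mul_nonneg hε (sq_nonneg (V t))]) (sub_pos.2 hUV0)
  have hS : StrictAntiOn (fun t => U t + V t) (Set.Ici 0) := by
    apply strictAntiOn_of_deriv_neg (convex_Ici 0) (by fun_prop)
    intro t ht
    rw [interior_Ici] at ht
    have ht' : 0 ≤ t := le_of_lt ht
    have hd : deriv (fun t => U t + V t) t = _ := ((hU t ht').add (hV t ht')).deriv
    rw [hd]
    have h1 := pV t ht'
    have h2 := pW t ht'
    have h3 : 0 < U t * V t := mul_pos (by linarith) h1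
    have h4 := mul_nonneg h3.le (sub_nonneg.2 (Real.cos_le_one Δ))
    nlinarith [mul_nonneg hε (sq_nonneg (V t)), mul_pos h2 h2]
  refine ⟨fun t ht => ⟨sub_pos.1 (pW t ht), pV t ht⟩, hS, fun t ht => ?_⟩
  exact hS.antitoneOn (Set.mem_Ici.2 le_rfl) (Set.mem_Ici.2 ht) ht
end

section
/- Let Δ ∈ (0, π/2), ε > 0, and T > 0. Suppose U, V : [0, T] → ℝ are differentiable and satisfy U′(t) = U(t)V(t)·cos Δ − U(t)², V′(t) = U(t)V(t)·cos Δ − (1+ε)·V(t)², with U(t) > 0, V(t) > 0, and (1 + cos Δ)·U(t) > (1 + cos Δ + ε)·V(t) for all t ∈ [0, T]. Setting Z(t) := U(t)/V(t), the following first-integral identity holds for all t ∈ [0, T]: log(V(t)/V(0)) = −((1+ε)/(1 + cos Δ + ε))·log(Z(t)/Z(0)) + ((sin²Δ + ε)/((1 + cos Δ + ε)(1 + cos Δ)))·log( ((1 + cos Δ)Z(t) − (1 + cos Δ + ε)) / ((1 + cos Δ)Z(0) − (1 + cos Δ + ε)) ). -/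
/-- First-integral identity of the Phase II system `U' = UV cos Δ - U²`,
`V' = UV cos Δ - (1+ε)V²` in the region `(1 + cos Δ)U > (1 + cos Δ + ε)V`:
with `Z = U/V`,
`log(V(t)/V(0)) = -((1+ε)/(1+cos Δ+ε)) log(Z(t)/Z(0))
  + ((sin²Δ+ε)/((1+cos Δ+ε)(1+cos Δ))) log(((1+cos Δ)Z(t) - (1+cos Δ+ε))/((1+cos Δ)Z(0) - (1+cos Δ+ε)))`. -/
theorem stmt8 (Δ ε T : ℝ) (hΔ : Δ ∈ Set.Ioo 0 (Real.pi / 2)) (hε : 0 < ε) (hT : 0 < T)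
    (U V : ℝ → ℝ)
    (hU : ∀ t ∈ Set.Icc 0 T, HasDerivAt U (U t * V t * Real.cos Δ - (U t) ^ 2) t)
    (hV : ∀ t ∈ Set.Icc 0 T,
      HasDerivAt V (U t * V t * Real.cos Δ - (1 + ε) * (V t) ^ 2) t)
    (hUpos : ∀ t ∈ Set.Icc 0 T, 0 < U t)
    (hVpos : ∀ t ∈ Set.Icc 0 T, 0 < V t)
    (hreg : ∀ t ∈ Set.Icc 0 T, (1 + Real.cos Δ + ε) * V t < (1 + Real.cos Δ) * U t) :
    ∀ t ∈ Set.Icc 0 T,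
      Real.log (V t / V 0) =
        -((1 + ε) / (1 + Real.cos Δ + ε)) * Real.log ((U t / V t) / (U 0 / V 0)) +
        ((Real.sin Δ ^ 2 + ε) / ((1 + Real.cos Δ + ε) * (1 + Real.cos Δ))) *
          Real.log (((1 + Real.cos Δ) * (U t / V t) - (1 + Real.cos Δ + ε)) /
            ((1 + Real.cos Δ) * (U 0 / V 0) - (1 + Real.cos Δ + ε))) := by
  have hc : 0 < Real.cos Δ :=
    Real.cos_pos_of_mem_Ioo ⟨by linarith [hΔ.1, Real.pi_pos], hΔ.2⟩
  have hs : Real.sin Δ ^ 2 = 1 - Real.cos Δ ^ 2 := Real.sin_sq Δ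
  rw [hs]
  generalize Real.cos Δ = c at *
  have hk : 0 < 1 + c + ε := by linarith
  have hk1 : 0 < 1 + c := by linarith
  have hZpos : ∀ t ∈ Set.Icc 0 T, 0 < U t / V t := fun t ht =>
    div_pos (hUpos t ht) (hVpos t ht)
  have hWpos : ∀ t ∈ Set.Icc 0 T, 0 < (1 + c) * (U t / V t) - (1 + c + ε) := by
    intro t ht
    have h := hVpos t ht
    have h2 := hreg t ht
    rw [← mul_div_assoc, sub_pos, lt_div_iff₀ h]
    exact h2
  have hF : ∀ t ∈ Set.Icc 0 T, HasDerivAt (fun t => Real.log (V t)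
      + ((1 + ε) / (1 + c + ε)) * Real.log (U t / V t)
      - ((1 - c ^ 2 + ε) / ((1 + c + ε) * (1 + c))) *
        Real.log ((1 + c) * (U t / V t) - (1 + c + ε))) 0 t := by
    intro t ht
    have hv := hVpos t ht
    have hu := hUpos t ht
    have hz := hZpos t ht
    have hw := hWpos t ht
    have dZ : HasDerivAt (fun t => U t / V t)
        (-(U t * ((1 + c) * (U t / V t) - (1 + c + ε)))) t := by
      refine ((hU t ht).fun_div (hV t ht) hv.ne').congr_deriv ?_
      field_simp
      ring
    have dW := (dZ.const_mul (1 + c)).sub_const (1 + c + ε)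
    refine ((((hV t ht).log hv.ne').add ((dZ.log hz.ne').const_mul _)).sub
      ((dW.log hw.ne').const_mul _)).congr_deriv ?_
    have e1 : (1 + c) * -(U t * ((1 + c) * (U t / V t) - (1 + c + ε))) /
        ((1 + c) * (U t / V t) - (1 + c + ε)) = -((1 + c) * U t) := by
      rw [div_eq_iff hw.ne']
      ring
    rw [e1]
    field_simp
    ring
  intro t ht
  have h0 : (0 : ℝ) ∈ Set.Icc 0 T := ⟨le_rfl, hT.le⟩
  have key := constant_of_has_deriv_right_zero
    (fun x hx => (hF x hx).continuousAt.continuousWithinAt)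
    (fun x hx => (hF x ⟨hx.1, hx.2.le⟩).hasDerivWithinAt) t ht
  rw [Real.log_div (hVpos t ht).ne' (hVpos 0 h0).ne',
    Real.log_div (hZpos t ht).ne' (hZpos 0 h0).ne',
    Real.log_div (hWpos t ht).ne' (hWpos 0 h0).ne']
  linarith [key]
end

section
/- Let Δ ∈ (0, π/2) and ε > 0 satisfy 1 + 2ε < 2 cos Δ. Suppose U, V : [0, ∞) → ℝ are differentiable and satisfy U′(t) = U(t)V(t)·cos Δ − U(t)², V′(t) = U(t)V(t)·cos Δ − (1+ε)·V(t)², with initial condition V(0) > 0 and U(0)·cos Δ = (1+ε)·V(0). Then for all t ≥ 0: (i) U(t) > 0 and V(t) > 0; (ii) (1 + ε/2)·V(t) < U(t) < ((1 + 2ε)/cos Δ)·V(t); (iii) V(t) ≥ 1/( 1/V(0) + ((1+ε) − (1+ε/2)·cos Δ)·t ); and (iv) U(t) ≤ 1/( 1/U(0) + (1 − cos Δ/(1+ε/2))·t ). -/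
lemma aux_mono (f f' : ℝ → ℝ) (hf : ∀ t, 0 ≤ t → HasDerivAt f (f' t) t)
    (h0 : ∀ t, 0 ≤ t → 0 ≤ f' t) (t : ℝ) (ht : 0 ≤ t) : f 0 ≤ f t := by
  have hm : MonotoneOn f (Set.Ici 0) := by
    apply monotoneOn_of_deriv_nonneg (convex_Ici 0)
    · intro x hx
      exact (hf x hx).continuousAt.continuousWithinAt
    · intro x hx
      rw [interior_Ici] at hx
      exact (hf x (le_of_lt hx)).differentiableAt.differentiableWithinAt
    · intro x hx
      rw [interior_Ici] at hx
      rw [(hf x (le_of_lt hx)).deriv]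
      exact h0 x (le_of_lt hx)
  exact hm (Set.mem_Ici.2 le_rfl) (Set.mem_Ici.2 ht) ht

lemma aux_pos (f g h : ℝ → ℝ) (hg : ∀ t, 0 ≤ t → ContinuousAt g t)
    (hf : ∀ t, 0 ≤ t → HasDerivAt f (g t * f t + h t) t)
    (hh : ∀ t, 0 ≤ t → 0 ≤ h t) (h0 : 0 < f 0) (t : ℝ) (ht : 0 ≤ t) : 0 < f t := by
  have hc : Continuous (fun s => g (max s 0)) := by
    rw [continuous_iff_continuousAt]
    intro x
    have h1 : ContinuousAt (fun s : ℝ => max s 0) x := by fun_prop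
    exact ContinuousAt.comp (f := fun s : ℝ => max s 0) (hg _ (le_max_right _ _)) h1
  have hG : ∀ s, 0 ≤ s →
      HasDerivAt (fun x => ∫ y in (0 : ℝ)..x, g (max y 0)) (g s) s := by
    intro s hs
    have := hc.integral_hasStrictDerivAt 0 s
    simpa [max_eq_left hs] using this.hasDerivAt
  set G := fun x => ∫ y in (0 : ℝ)..x, g (max y 0) with hGdef
  have key := aux_mono (fun s => f s * Real.exp (-G s)) (fun s => h s * Real.exp (-G s))
    (by
      intro s hs
      have := (hf s hs).mul ((hG s hs).neg.exp)
      refine HasDerivAt.congr_deriv this ?_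
      simp only [Pi.neg_apply]
      ring)
    (fun s hs => mul_nonneg (hh s hs) (Real.exp_pos _).le) t ht
  have h2 : 0 < f 0 * Real.exp (-G 0) := mul_pos h0 (Real.exp_pos _)
  exact pos_of_mul_pos_left (lt_of_lt_of_le h2 key) (Real.exp_pos _).le

/-- Late-phase estimates for the Phase II system starting at the crossing time
`U(0) cos Δ = (1+ε) V(0)`: positivity, the two-sided ratio bound
`(1 + ε/2) V < U < ((1+2ε)/cos Δ) V`, and hyperbolic decay bounds on `U` and `V`. -/
theorem stmt9 (Δ ε : ℝ) (hΔ : Δ ∈ Set.Ioo 0 (Real.pi / 2)) (hε : 0 < ε)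
    (hsmall : 1 + 2 * ε < 2 * Real.cos Δ)
    (U V : ℝ → ℝ)
    (hU : ∀ t, 0 ≤ t → HasDerivAt U (U t * V t * Real.cos Δ - (U t) ^ 2) t)
    (hV : ∀ t, 0 ≤ t → HasDerivAt V (U t * V t * Real.cos Δ - (1 + ε) * (V t) ^ 2) t)
    (hV0 : 0 < V 0) (hcross : U 0 * Real.cos Δ = (1 + ε) * V 0) :
    ∀ t, 0 ≤ t →
      (0 < U t ∧ 0 < V t) ∧
      ((1 + ε / 2) * V t < U t ∧ U t < ((1 + 2 * ε) / Real.cos Δ) * V t) ∧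
      1 / (1 / V 0 + ((1 + ε) - (1 + ε / 2) * Real.cos Δ) * t) ≤ V t ∧
      U t ≤ 1 / (1 / U 0 + (1 - Real.cos Δ / (1 + ε / 2)) * t) := by
  have hc1 : Real.cos Δ < 1 := by
    have := Real.cos_lt_cos_of_nonneg_of_le_pi_div_two le_rfl hΔ.2.le hΔ.1
    simpa using this
  have hc0 : 0 < Real.cos Δ := by linarith
  set c := Real.cos Δ with hc
  have hU0 : 0 < U 0 := by
    have : 0 < U 0 * c := by rw [hcross]; positivity
    exact pos_of_mul_pos_left this hc0.le
  have cU : ∀ t, 0 ≤ t → ContinuousAt U t := fun t ht => (hU t ht).continuousAt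
  have cV : ∀ t, 0 ≤ t → ContinuousAt V t := fun t ht => (hV t ht).continuousAt
  have pV : ∀ t, 0 ≤ t → 0 < V t :=
    aux_pos V (fun t => U t * c - (1 + ε) * V t) (fun _ => 0)
      (fun t ht => by have := cU t ht; have := cV t ht; fun_prop)
      (fun t ht => by convert hV t ht using 1; ring) (fun _ _ => le_rfl) hV0
  have pU : ∀ t, 0 ≤ t → 0 < U t :=
    aux_pos U (fun t => V t * c - U t) (fun _ => 0)
      (fun t ht => by have := cU t ht; have := cV t ht; fun_prop)
      (fun t ht => by convert hU t ht using 1; ring) (fun _ _ => le_rfl) hU0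
  have pW : ∀ t, 0 ≤ t → 0 < U t - (1 + ε / 2) * V t :=
    aux_pos (fun t => U t - (1 + ε / 2) * V t)
      (fun t => V t * c - U t - (1 + ε / 2) * V t * (1 + c))
      (fun t => (1 + ε / 2) * V t ^ 2 * ((c + 1 + ε) - (1 + c) * (1 + ε / 2)))
      (fun t ht => by have := cU t ht; have := cV t ht; fun_prop)
      (fun t ht => by
        exact ((hU t ht).sub ((hV t ht).const_mul (1 + ε / 2))).congr_deriv (by ring))
      (fun t ht => by
        have : 0 ≤ (c + 1 + ε) - (1 + c) * (1 + ε / 2) := by nlinarith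
        positivity)
      (by
        have h1 : U 0 * c < U 0 * 1 := mul_lt_mul_of_pos_left hc1 hU0
        have h2 : 0 < ε * V 0 := by positivity
        show 0 < U 0 - (1 + ε / 2) * V 0
        nlinarith)
  obtain ⟨m, hm⟩ : ∃ m, m = (1 + 2 * ε) / c := ⟨_, rfl⟩
  have hmc : m * c = 1 + 2 * ε := by rw [hm]; field_simp
  have hm0 : 0 < m := by rw [hm]; positivity
  have hm1 : 1 + 2 * ε < m := by
    rw [← hmc]; exact mul_lt_of_lt_one_right hm0 hc1
  have pZ : ∀ t, 0 ≤ t → 0 < m * V t - U t :=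
    aux_pos (fun t => m * V t - U t)
      (fun t => V t * c - U t - m * V t * (1 + c))
      (fun t => m * V t ^ 2 * ((1 + c) * m - (c + 1 + ε)))
      (fun t ht => by have := cU t ht; have := cV t ht; fun_prop)
      (fun t ht => by
        exact (((hV t ht).const_mul m).sub (hU t ht)).congr_deriv (by ring))
      (fun t ht => by
        have : 0 ≤ (1 + c) * m - (c + 1 + ε) := by nlinarith
        positivity)
      (by
        have h2 : 0 < ε * V 0 := by positivity
        have h3 : 0 < (m * V 0 - U 0) * c := by
          have : (m * V 0 - U 0) * c = (m * c) * V 0 - U 0 * c := by ring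
          rw [this, hmc, hcross]; linarith
        exact pos_of_mul_pos_left h3 hc0.le)
  have hk : 0 < 1 + ε / 2 := by positivity
  intro t ht
  refine ⟨⟨pU t ht, pV t ht⟩, ⟨by linarith [pW t ht], by rw [← hm]; linarith [pZ t ht]⟩, ?_, ?_⟩
  · have key := aux_mono
      (fun s => ((1 + ε) - (1 + ε / 2) * c) * s - (V s)⁻¹)
      (fun s => ((1 + ε) - (1 + ε / 2) * c) * 1
        - (-(U s * V s * c - (1 + ε) * (V s) ^ 2) / (V s) ^ 2))
      (fun s hs => ((hasDerivAt_id s).const_mul _).sub ((hV s hs).inv (pV s hs).ne'))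
      (fun s hs => by
        have hv := pV s hs
        have : ((1 + ε) - (1 + ε / 2) * c) * 1
          - (-(U s * V s * c - (1 + ε) * (V s) ^ 2) / (V s) ^ 2)
          = c * (U s - (1 + ε / 2) * V s) / V s := by
          field_simp; ring
        rw [this]
        have := pW s hs
        positivity) t ht
    simp only [mul_zero, zero_sub] at key
    have hv := pV t ht
    rw [one_div, one_div]
    apply inv_le_of_inv_le₀ hv
    linarith
  · have hkc : 0 < 1 - c / (1 + ε / 2) := by
      rw [sub_pos, div_lt_one hk]; linarith
    have key := aux_mono
      (fun s => (U s)⁻¹ - (1 - c / (1 + ε / 2)) * s)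
      (fun s => -(U s * V s * c - (U s) ^ 2) / (U s) ^ 2 - (1 - c / (1 + ε / 2)) * 1)
      (fun s hs => ((hU s hs).inv (pU s hs).ne').sub ((hasDerivAt_id s).const_mul _))
      (fun s hs => by
        have hu := pU s hs
        have : -(U s * V s * c - (U s) ^ 2) / (U s) ^ 2 - (1 - c / (1 + ε / 2)) * 1
          = c * (U s - (1 + ε / 2) * V s) / ((1 + ε / 2) * U s) := by
          field_simp; ring
        rw [this]
        have := pW s hs
        positivity) t ht
    simp only [mul_zero, sub_zero] at key
    have hu := pU t ht
    rw [one_div, one_div]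
    apply le_inv_of_le_inv₀ (by positivity)
    linarith
end

section
/- Let Δ ∈ (0, π/2) and α > 0 with α·cos Δ < 1, and set ε := α·sin²Δ. Suppose U, V : [0, ∞) → ℝ are differentiable with U(0) > 0 and V(0) > 0, satisfying U′(t) = U(t)V(t)·cos Δ − U(t)² and V′(t) = U(t)V(t)·cos Δ − (1+ε)·V(t)² for all t ≥ 0. If at some time t₀ ≥ 0 one has U(t₀)·cos Δ ≤ V(t₀), then U(t)·cos Δ < V(t) for all t > t₀. -/
theorem aux_antideriv (h : ℝ → ℝ) (hh : ∀ t, 0 ≤ t → ContinuousAt h t) :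
    ∃ H : ℝ → ℝ, ∀ t, 0 ≤ t → HasDerivAt H (h t) t := by
  have hc : Continuous (fun t => h (max t 0)) := by
    rw [continuous_iff_continuousAt]
    intro t
    exact ContinuousAt.comp (f := fun t : ℝ => max t 0) (hh _ (le_max_right _ _)) (by fun_prop)
  refine ⟨fun t => ∫ x in (0:ℝ)..t, h (max x 0), fun t ht => ?_⟩
  have := intervalIntegral.integral_hasDerivAt_right (hc.intervalIntegrable 0 t)
    (hc.stronglyMeasurableAtFilter _ _) hc.continuousAt
  simpa [max_eq_left ht] using this

/-- Once the vector-field component `U cos Δ - V` of the Phase II system becomes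
nonpositive, it stays strictly negative forever: if `U(t₀) cos Δ ≤ V(t₀)` then
`U(t) cos Δ < V(t)` for all `t > t₀`. -/
theorem stmt10 (Δ α : ℝ) (hΔ : Δ ∈ Set.Ioo 0 (Real.pi / 2)) (hα : 0 < α)
    (hαcos : α * Real.cos Δ < 1)
    (U V : ℝ → ℝ)
    (hU0 : 0 < U 0) (hV0 : 0 < V 0)
    (hU : ∀ t, 0 ≤ t →
      HasDerivAt U (U t * V t * Real.cos Δ - (U t) ^ 2) t)
    (hV : ∀ t, 0 ≤ t →
      HasDerivAt V
        (U t * V t * Real.cos Δ - (1 + α * Real.sin Δ ^ 2) * (V t) ^ 2) t)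
    (t₀ : ℝ) (ht₀ : 0 ≤ t₀) (hcross : U t₀ * Real.cos Δ ≤ V t₀) :
    ∀ t, t₀ < t → U t * Real.cos Δ < V t := by
  obtain ⟨h0, h1⟩ := hΔ
  have hc : 0 < Real.cos Δ := Real.cos_pos_of_mem_Ioo ⟨by linarith, h1⟩
  have hs : 0 < Real.sin Δ := Real.sin_pos_of_pos_of_lt_pi h0 (by linarith [Real.pi_pos])
  have hsc := Real.sin_sq_add_cos_sq Δ
  set c := Real.cos Δ
  set s := Real.sin Δ
  have hUc : ∀ t, 0 ≤ t → ContinuousAt U t := fun t ht => (hU t ht).continuousAt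
  have hVc : ∀ t, 0 ≤ t → ContinuousAt V t := fun t ht => (hV t ht).continuousAt
  -- positivity of U
  have hUpos : ∀ t, 0 ≤ t → 0 < U t := by
    obtain ⟨G, hG⟩ := aux_antideriv (fun t => V t * c - U t)
      (fun t ht => ((hVc t ht).mul continuousAt_const).sub (hUc t ht))
    have hd : ∀ t, 0 ≤ t → HasDerivAt (fun t => U t * Real.exp (-G t)) 0 t := by
      intro t ht
      refine ((hU t ht).mul (hG t ht).neg.exp).congr_deriv ?_
      simp only [Pi.neg_apply]
      ring
    have hm : MonotoneOn (fun t => U t * Real.exp (-G t)) (Set.Ici 0) := by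
      apply monotoneOn_of_deriv_nonneg (convex_Ici 0)
      · exact fun t ht => (hd t ht).continuousAt.continuousWithinAt
      · intro t ht
        exact (hd t (interior_subset ht)).differentiableAt.differentiableWithinAt
      · intro t ht
        rw [(hd t (interior_subset ht)).deriv]
    intro t ht
    have h2 : U 0 * Real.exp (-G 0) ≤ U t * Real.exp (-G t) :=
      hm Set.self_mem_Ici ht ht
    have h3 : 0 < U 0 * Real.exp (-G 0) := by positivity
    exact pos_of_mul_pos_left (h3.trans_le h2) (Real.exp_pos _).le
  -- linear differential inequality for U c - V
  obtain ⟨H, hH⟩ := aux_antideriv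
    (fun t => -c ^ 2 * U t + c * U t - 2 * (1 + α * s ^ 2) * c * U t
      + (1 + α * s ^ 2) * (U t * c - V t))
    (fun t ht => by
      have := hUc t ht
      have := hVc t ht
      fun_prop)
  have hd : ∀ t, 0 ≤ t → HasDerivAt (fun t => (U t * c - V t) * Real.exp (-H t))
      (-(c * s ^ 2 * (1 - α * c) * U t ^ 2 * Real.exp (-H t))) t := by
    intro t ht
    refine ((((hU t ht).mul_const c).sub (hV t ht)).mul (hH t ht).neg.exp).congr_deriv ?_
    have hs2 : s ^ 2 = 1 - c ^ 2 := by linarith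
    simp only [Pi.sub_apply, Pi.neg_apply, hs2]
    ring
  have hm : StrictAntiOn (fun t => (U t * c - V t) * Real.exp (-H t)) (Set.Ici 0) := by
    apply strictAntiOn_of_deriv_neg (convex_Ici 0)
    · exact fun t ht => (hd t ht).continuousAt.continuousWithinAt
    · intro t ht
      have ht' : 0 ≤ t := interior_subset ht
      rw [(hd t ht').deriv]
      have := hUpos t ht'
      have : 0 < 1 - α * c := by linarith
      have : 0 < c * s ^ 2 * (1 - α * c) * U t ^ 2 * Real.exp (-H t) := by positivity
      linarith
  intro t ht
  have h2 : (U t * c - V t) * Real.exp (-H t) < (U t₀ * c - V t₀) * Real.exp (-H t₀) :=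
    hm ht₀ (ht₀.trans ht.le) ht
  have h3 : (U t₀ * c - V t₀) * Real.exp (-H t₀) ≤ 0 :=
    mul_nonpos_of_nonpos_of_nonneg (by linarith) (Real.exp_pos _).le
  have h4 := Real.exp_pos (-H t)
  by_contra hcon
  have h5 : 0 ≤ (U t * c - V t) * Real.exp (-H t) :=
    mul_nonneg (by linarith) h4.le
  linarith
end

section
/- Let C₀ > 0, B ≥ 0, a ∈ ℝ, and T > 0. Suppose f : [0, T] → ℝ is continuous, f(0) = B − a, and for all t ∈ [0, T] it satisfies the two-sided integral inequality −C₀·∫₀ᵗ e^{f(s)} ds − a ≤ f(t) ≤ −C₀·∫₀ᵗ e^{f(s)} ds − a + B. Then for all t ∈ [0, T]: e^{−B}/(1 + C₀·e^{f(0)}·t) ≤ e^{f(t) − f(0)} ≤ 1/(1 + C₀·e^{f(0)−B}·t). -/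
/-- Grönwall-type estimate for the phase transition: if a continuous `f` on `[0, T]`
with `f(0) = B - a` satisfies
`-C₀ ∫₀ᵗ e^{f(s)} ds - a ≤ f(t) ≤ -C₀ ∫₀ᵗ e^{f(s)} ds - a + B`,
then `e^{-B}/(1 + C₀ e^{f(0)} t) ≤ e^{f(t) - f(0)} ≤ 1/(1 + C₀ e^{f(0)-B} t)`. -/
theorem stmt11 (C₀ B a T : ℝ) (hC₀ : 0 < C₀) (hB : 0 ≤ B) (hT : 0 < T)
    (f : ℝ → ℝ) (hf : ContinuousOn f (Set.Icc 0 T)) (hf0 : f 0 = B - a)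
    (hineq : ∀ t ∈ Set.Icc (0 : ℝ) T,
      -C₀ * (∫ s in (0 : ℝ)..t, Real.exp (f s)) - a ≤ f t ∧
      f t ≤ -C₀ * (∫ s in (0 : ℝ)..t, Real.exp (f s)) - a + B) :
    ∀ t ∈ Set.Icc (0 : ℝ) T,
      Real.exp (-B) / (1 + C₀ * Real.exp (f 0) * t) ≤ Real.exp (f t - f 0) ∧
      Real.exp (f t - f 0) ≤ 1 / (1 + C₀ * Real.exp (f 0 - B) * t) := by
  obtain ⟨g, hg, hgf⟩ : ∃ g : ℝ → ℝ, Continuous g ∧ ∀ s ∈ Set.Icc (0 : ℝ) T, g s = f s := by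
    refine ⟨Set.IccExtend hT.le ((Set.Icc 0 T).restrict f), ?_, ?_⟩
    · exact (continuousOn_iff_continuous_restrict.mp hf).Icc_extend'
    · intro s hs
      rw [Set.IccExtend_of_mem hT.le _ hs]
      rfl
  have hint : ∀ t ∈ Set.Icc (0 : ℝ) T,
      (∫ s in (0 : ℝ)..t, Real.exp (f s)) = ∫ s in (0 : ℝ)..t, Real.exp (g s) := by
    intro t ht
    apply intervalIntegral.integral_congr
    intro s hs
    rw [Set.uIcc_of_le ht.1] at hs
    simp only [hgf s ⟨hs.1, hs.2.trans ht.2⟩]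
  set I : ℝ → ℝ := fun t => ∫ s in (0 : ℝ)..t, Real.exp (g s) with hI
  have hId : ∀ t, HasDerivAt I (Real.exp (g t)) t := fun t =>
    ((Real.continuous_exp.comp hg).integral_hasStrictDerivAt 0 t).hasDerivAt
  have hI0 : I 0 = 0 := by simp [hI]
  have hEd : ∀ t, HasDerivAt (fun t => Real.exp (C₀ * I t))
      (Real.exp (C₀ * I t) * (C₀ * Real.exp (g t))) t := fun t =>
    ((hId t).const_mul C₀).exp
  have hlin : ∀ c t : ℝ, HasDerivAt (fun t : ℝ => c * t) c t := fun c t => by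
    simpa using (hasDerivAt_id t).const_mul c
  have hb : ∀ t ∈ Set.Icc (0 : ℝ) T, -C₀ * I t - a ≤ g t ∧ g t ≤ -C₀ * I t - a + B := by
    intro t ht
    have := hineq t ht
    rw [hint t ht, ← hgf t ht] at this
    exact this
  have hmono1 : MonotoneOn (fun t => C₀ * Real.exp (B - a) * t - Real.exp (C₀ * I t))
      (Set.Icc 0 T) := by
    have hd := fun t => (hlin (C₀ * Real.exp (B - a)) t).fun_sub (hEd t)
    apply monotoneOn_of_deriv_nonneg (convex_Icc 0 T)
    · exact fun t _ => (hd t).continuousAt.continuousWithinAt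
    · exact fun t _ => (hd t).differentiableAt.differentiableWithinAt
    · intro t ht
      rw [(hd t).deriv]
      have h := (hb t (interior_subset ht)).2
      have h2 : Real.exp (C₀ * I t) * Real.exp (g t) ≤ Real.exp (B - a) := by
        rw [← Real.exp_add]
        exact Real.exp_le_exp.mpr (by linarith)
      nlinarith [mul_le_mul_of_nonneg_left h2 hC₀.le]
  have hmono2 : MonotoneOn (fun t => Real.exp (C₀ * I t) - C₀ * Real.exp (-a) * t)
      (Set.Icc 0 T) := by
    have hd := fun t => (hEd t).fun_sub (hlin (C₀ * Real.exp (-a)) t)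
    apply monotoneOn_of_deriv_nonneg (convex_Icc 0 T)
    · exact fun t _ => (hd t).continuousAt.continuousWithinAt
    · exact fun t _ => (hd t).differentiableAt.differentiableWithinAt
    · intro t ht
      rw [(hd t).deriv]
      have h := (hb t (interior_subset ht)).1
      have h2 : Real.exp (-a) ≤ Real.exp (C₀ * I t) * Real.exp (g t) := by
        rw [← Real.exp_add]
        exact Real.exp_le_exp.mpr (by linarith)
      nlinarith [mul_le_mul_of_nonneg_left h2 hC₀.le]
  intro t ht
  have h0 : (0 : ℝ) ∈ Set.Icc 0 T := ⟨le_rfl, hT.le⟩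
  have h1 := hmono1 h0 ht ht.1
  have h2 := hmono2 h0 ht ht.1
  simp only [hI0, mul_zero, Real.exp_zero] at h1 h2
  obtain ⟨hl, hu⟩ := hb t ht
  rw [hgf t ht] at hl hu
  have ht0 := ht.1
  rw [hf0, show B - a - B = -a by ring]
  have hE := Real.exp_pos (f t - (B - a))
  constructor
  · rw [div_le_iff₀ (by positivity)]
    calc Real.exp (-B) ≤ Real.exp (f t - (B - a)) * Real.exp (C₀ * I t) := by
          rw [← Real.exp_add]
          exact Real.exp_le_exp.mpr (by linarith)
      _ ≤ _ := mul_le_mul_of_nonneg_left (by linarith) hE.le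
  · rw [le_div_iff₀ (by positivity)]
    calc _ ≤ Real.exp (f t - (B - a)) * Real.exp (C₀ * I t) :=
          mul_le_mul_of_nonneg_left (by linarith) hE.le
      _ ≤ 1 := by
          rw [← Real.exp_add]
          exact Real.exp_le_one_iff.mpr (by linarith)
end

section
/- Let G₊ > 0, G₋ > 0, p > 0, and Δ ∈ (0, π/2). Suppose f₊, f₋ : [0, ∞) → ℝ are differentiable and satisfy f₊′(t) = G₊·e^{−f₊(t)} and f₋′(t) = −G₋·e^{f₋(t)} for all t ≥ 0. Then: (i) e^{−f₊(t)} = e^{−f₊(0)}/(1 + G₊·e^{−f₊(0)}·t) and e^{f₋(t)} = e^{f₋(0)}/(1 + G₋·e^{f₋(0)}·t) for all t ≥ 0; (ii) p·e^{−f₊(t)} − cos Δ·e^{f₋(t)} = [ (p·e^{−f₊(0)} − cos Δ·e^{f₋(0)}) + e^{f₋(0)−f₊(0)}·(p·G₋ − G₊·cos Δ)·t ] / ( (1 + G₊·e^{−f₊(0)}·t)(1 + G₋·e^{f₋(0)}·t) ); (iii) if moreover p·e^{−f₊(0)} > cos Δ·e^{f₋(0)} and p·G₋ < G₊·cos Δ,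 then setting t* := (p·e^{−f₊(0)} − cos Δ·e^{f₋(0)})·e^{f₊(0)−f₋(0)}/(G₊·cos Δ − p·G₋), the quantity p·e^{−f₊(t)} − cos Δ·e^{f₋(t)} is positive for t ∈ [0, t*), zero at t = t*, and negative for t > t*. -/
theorem phase_aux (G : ℝ) (hG : 0 < G) (g : ℝ → ℝ)
    (hg : ∀ t, 0 ≤ t → HasDerivAt g (G * Real.exp (-g t)) t) (t : ℝ) (ht : 0 ≤ t) :
    Real.exp (-g t) = Real.exp (-g 0) / (1 + G * Real.exp (-g 0) * t) := by
  have hd : ∀ s, 0 ≤ s → HasDerivAt (fun s => Real.exp (g s) - G * s) 0 s := by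
    intro s hs
    have h1 := (hg s hs).exp.sub ((hasDerivAt_id s).const_mul G)
    have h2 : Real.exp (g s) * (G * Real.exp (-g s)) - G * 1 = 0 := by
      rw [Real.exp_neg]
      field_simp
      ring
    rw [h2] at h1
    exact h1
  have hc := constant_of_has_deriv_right_zero (f := fun s => Real.exp (g s) - G * s)
    (a := 0) (b := t)
    (fun s hs => (hd s hs.1).continuousAt.continuousWithinAt)
    (fun s hs => (hd s hs.1).hasDerivWithinAt) t ⟨ht, le_rfl⟩
  have h3 : Real.exp (g t) = Real.exp (g 0) + G * t := by
    simp only [mul_zero, sub_zero] at hc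
    linarith
  have h0 := Real.exp_pos (g 0)
  have h4 : 0 ≤ G * t := by positivity
  rw [Real.exp_neg, Real.exp_neg, h3]
  field_simp

/-- Explicit solution of the decoupled Phase III dynamics `f₊' = G₊ e^{-f₊}`,
`f₋' = -G₋ e^{f₋}`, together with the explicit evolution and sign change of
`p e^{-f₊} - cos Δ · e^{f₋}` at the explicit time `t*`. -/
theorem stmt12 (Gp Gm p Δ : ℝ) (hGp : 0 < Gp) (hGm : 0 < Gm) (hp : 0 < p)
    (hΔ : Δ ∈ Set.Ioo 0 (Real.pi / 2))
    (fp fm : ℝ → ℝ)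
    (hfp : ∀ t, 0 ≤ t → HasDerivAt fp (Gp * Real.exp (-fp t)) t)
    (hfm : ∀ t, 0 ≤ t → HasDerivAt fm (-Gm * Real.exp (fm t)) t) :
    (∀ t, 0 ≤ t →
      Real.exp (-fp t) = Real.exp (-fp 0) / (1 + Gp * Real.exp (-fp 0) * t) ∧
      Real.exp (fm t) = Real.exp (fm 0) / (1 + Gm * Real.exp (fm 0) * t)) ∧
    (∀ t, 0 ≤ t →
      p * Real.exp (-fp t) - Real.cos Δ * Real.exp (fm t) =
        ((p * Real.exp (-fp 0) - Real.cos Δ * Real.exp (fm 0)) +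
          Real.exp (fm 0 - fp 0) * (p * Gm - Gp * Real.cos Δ) * t) /
        ((1 + Gp * Real.exp (-fp 0) * t) * (1 + Gm * Real.exp (fm 0) * t))) ∧
    (Real.cos Δ * Real.exp (fm 0) < p * Real.exp (-fp 0) →
      p * Gm < Gp * Real.cos Δ →
      ∀ tstar : ℝ,
        tstar = (p * Real.exp (-fp 0) - Real.cos Δ * Real.exp (fm 0)) *
          Real.exp (fp 0 - fm 0) / (Gp * Real.cos Δ - p * Gm) →
        (∀ t, 0 ≤ t → t < tstar →
          0 < p * Real.exp (-fp t) - Real.cos Δ * Real.exp (fm t)) ∧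
        p * Real.exp (-fp tstar) - Real.cos Δ * Real.exp (fm tstar) = 0 ∧
        (∀ t, tstar < t →
          p * Real.exp (-fp t) - Real.cos Δ * Real.exp (fm t) < 0)) := by
  have hA : ∀ t, 0 ≤ t →
      Real.exp (-fp t) = Real.exp (-fp 0) / (1 + Gp * Real.exp (-fp 0) * t) ∧
      Real.exp (fm t) = Real.exp (fm 0) / (1 + Gm * Real.exp (fm 0) * t) := by
    intro t ht
    refine ⟨phase_aux Gp hGp fp hfp t ht, ?_⟩
    have h := phase_aux Gm hGm (fun s => -fm s) (fun s hs => by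
      have := (hfm s hs).neg
      simp only [neg_mul, neg_neg] at this ⊢
      exact this) t ht
    simpa only [neg_neg] using h
  have hB : ∀ t, 0 ≤ t →
      p * Real.exp (-fp t) - Real.cos Δ * Real.exp (fm t) =
        ((p * Real.exp (-fp 0) - Real.cos Δ * Real.exp (fm 0)) +
          Real.exp (fm 0 - fp 0) * (p * Gm - Gp * Real.cos Δ) * t) /
        ((1 + Gp * Real.exp (-fp 0) * t) * (1 + Gm * Real.exp (fm 0) * t)) := by
    intro t ht
    obtain ⟨h1, h2⟩ := hA t ht
    have e : Real.exp (fm 0 - fp 0) = Real.exp (fm 0) * Real.exp (-fp 0) := by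
      rw [← Real.exp_add, sub_eq_add_neg]
    rw [h1, h2, e]
    have ha := Real.exp_pos (-fp 0)
    have hb := Real.exp_pos (fm 0)
    generalize Real.exp (-fp 0) = a at *
    generalize Real.exp (fm 0) = b at *
    have p1 : 1 + Gp * a * t ≠ 0 := by positivity
    have p2 : 1 + Gm * b * t ≠ 0 := by positivity
    rw [mul_div_assoc', mul_div_assoc', div_sub_div _ _ p1 p2]
    congr 1
    ring
  refine ⟨hA, hB, ?_⟩
  intro hpos hlt tstar hts
  have hD : 0 < Gp * Real.cos Δ - p * Gm := by linarith
  have hN : 0 < p * Real.exp (-fp 0) - Real.cos Δ * Real.exp (fm 0) := by linarith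
  have hE := Real.exp_pos (fm 0 - fp 0)
  have hEE : Real.exp (fp 0 - fm 0) * Real.exp (fm 0 - fp 0) = 1 := by
    rw [← Real.exp_add]
    simp
  have hts0 : 0 < tstar := by
    rw [hts]
    positivity
  have hkey : p * Real.exp (-fp 0) - Real.cos Δ * Real.exp (fm 0) =
      Real.exp (fm 0 - fp 0) * (Gp * Real.cos Δ - p * Gm) * tstar := by
    have h5 : (Gp * Real.cos Δ - p * Gm) * tstar =
        (p * Real.exp (-fp 0) - Real.cos Δ * Real.exp (fm 0)) * Real.exp (fp 0 - fm 0) := by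
      rw [hts]
      exact mul_div_cancel₀ _ hD.ne'
    rw [mul_assoc, h5]
    linear_combination (-(p * Real.exp (-fp 0) - Real.cos Δ * Real.exp (fm 0))) * hEE
  have hC : ∀ t, 0 ≤ t → ∃ c : ℝ, 0 < c ∧
      p * Real.exp (-fp t) - Real.cos Δ * Real.exp (fm t) = c * (tstar - t) := by
    intro t ht
    refine ⟨Real.exp (fm 0 - fp 0) * (Gp * Real.cos Δ - p * Gm) /
      ((1 + Gp * Real.exp (-fp 0) * t) * (1 + Gm * Real.exp (fm 0) * t)), by positivity, ?_⟩
    rw [hB t ht, hkey]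
    ring
  refine ⟨?_, ?_, ?_⟩
  · intro t ht htl
    obtain ⟨c, hc, h⟩ := hC t ht
    rw [h]
    exact mul_pos hc (by linarith)
  · obtain ⟨c, hc, h⟩ := hC tstar hts0.le
    rw [h]
    ring
  · intro t htl
    obtain ⟨c, hc, h⟩ := hC t (by linarith)
    rw [h]
    exact mul_neg_of_pos_of_neg hc (by linarith)
end

section
/- Let Δ ∈ (0, π/2) and c > 0 with c·cos Δ > 1, and set ε := c·sin²Δ. Suppose I, J : [0, ∞) → ℝ are differentiable and satisfy I′(t) = I(t)J(t)·cos Δ − (1+ε)·I(t)² and J′(t) = I(t)J(t)·cos Δ − J(t)² for all t ≥ 0, with initial condition J(0) > 0 and I(0) = cos Δ·J(0). Then for all t ≥ 0: I(t) > 0, J(t) > 0, and ((1 + cos Δ)/(1 + cos Δ + ε))·J(t) < I(t); and for all t > 0: I(t) < cos Δ·J(t). -/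
lemma lin_pos (y g : ℝ → ℝ) (hg : ContinuousOn g (Set.Ici 0))
    (hy : ∀ t, 0 ≤ t → HasDerivAt y (g t * y t) t) (h0 : 0 < y 0) :
    ∀ t, 0 ≤ t → 0 < y t := by
  have hG : Continuous (fun t : ℝ => g (max t 0)) :=
    hg.comp_continuous (by fun_prop) (fun t => le_max_right t 0)
  set F : ℝ → ℝ := fun t => ∫ s in (0:ℝ)..t, g (max s 0) with hF
  have hFd : ∀ t, HasDerivAt F (g (max t 0)) t := fun t =>
    intervalIntegral.integral_hasDerivAt_right (hG.intervalIntegrable _ _)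
      hG.stronglyMeasurable.stronglyMeasurableAtFilter hG.continuousAt
  have hh : ∀ t, 0 ≤ t → HasDerivAt (fun t => y t * Real.exp (-F t)) 0 t := by
    intro t ht
    have := (hy t ht).mul (hFd t).neg.exp
    rw [max_eq_left ht] at this
    refine HasDerivAt.congr_deriv this ?_
    ring
  intro t ht
  have hc : y t * Real.exp (-F t) = y 0 * Real.exp (-F 0) := by
    apply constant_of_has_deriv_right_zero (a := 0) (b := t)
      (f := fun t => y t * Real.exp (-F t)) _ _ t ⟨ht, le_rfl⟩
    · intro x hx
      exact (hh x hx.1).continuousAt.continuousWithinAt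
    · intro x hx
      exact (hh x hx.1).hasDerivWithinAt
  have h1 : 0 < y t * Real.exp (-F t) := by rw [hc]; positivity
  exact pos_of_mul_pos_left h1 (Real.exp_pos _).le

/-- Phase IV system `I' = IJ cos Δ - (1+ε)I²`, `J' = IJ cos Δ - J²` starting at the
transition point `I(0) = cos Δ · J(0)`, `J(0) > 0`: positivity, the lower ratio bound
`((1+cos Δ)/(1+cos Δ+ε)) J < I` for all `t ≥ 0`, and `I < cos Δ · J` for all `t > 0`. -/
theorem stmt13 (Δ c : ℝ) (hΔ : Δ ∈ Set.Ioo 0 (Real.pi / 2)) (hc : 0 < c)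
    (hccos : 1 < c * Real.cos Δ)
    (I J : ℝ → ℝ)
    (hI : ∀ t, 0 ≤ t →
      HasDerivAt I
        (I t * J t * Real.cos Δ - (1 + c * Real.sin Δ ^ 2) * (I t) ^ 2) t)
    (hJ : ∀ t, 0 ≤ t →
      HasDerivAt J (I t * J t * Real.cos Δ - (J t) ^ 2) t)
    (hJ0 : 0 < J 0) (hI0 : I 0 = Real.cos Δ * J 0) :
    (∀ t, 0 ≤ t →
      0 < I t ∧ 0 < J t ∧
      ((1 + Real.cos Δ) / (1 + Real.cos Δ + c * Real.sin Δ ^ 2)) * J t < I t) ∧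
    (∀ t, 0 < t → I t < Real.cos Δ * J t) := by
  have hk : 0 < Real.cos Δ :=
    Real.cos_pos_of_mem_Ioo ⟨by linarith [hΔ.1, Real.pi_pos], hΔ.2⟩
  have hs : 0 < Real.sin Δ := Real.sin_pos_of_pos_of_lt_pi hΔ.1 (by linarith [hΔ.2, Real.pi_pos])
  have hsc := Real.sin_sq_add_cos_sq Δ
  have he : 0 < c * Real.sin Δ ^ 2 := by positivity
  have hek : 1 - Real.cos Δ ^ 2 < Real.cos Δ * (c * Real.sin Δ ^ 2) := by
    have : 0 < Real.sin Δ ^ 2 := by positivity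
    nlinarith
  generalize Real.cos Δ = k at *
  generalize c * Real.sin Δ ^ 2 = e at *
  have hIc : ContinuousOn I (Set.Ici 0) := fun t ht => (hI t ht).continuousAt.continuousWithinAt
  have hJc : ContinuousOn J (Set.Ici 0) := fun t ht => (hJ t ht).continuousAt.continuousWithinAt
  have hIp : ∀ t, 0 ≤ t → 0 < I t := by
    apply lin_pos I (fun t => J t * k - (1 + e) * I t) (by fun_prop)
    · intro t ht
      convert hI t ht using 1
      ring
    · rw [hI0]; positivity
  have hJp : ∀ t, 0 ≤ t → 0 < J t := by
    apply lin_pos J (fun t => I t * k - J t) (by fun_prop)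
    · intro t ht
      convert hJ t ht using 1
      ring
    · exact hJ0
  have hd : 0 < 1 + k + e := by positivity
  have hD : ∀ t, 0 ≤ t → 0 < (1 + k + e) * I t - (1 + k) * J t := by
    apply lin_pos (fun t => (1 + k + e) * I t - (1 + k) * J t)
      (fun t => - J t - (1 + e) * I t) (by fun_prop)
    · intro t ht
      refine HasDerivAt.congr_deriv
        (((hI t ht).const_mul (1 + k + e)).sub ((hJ t ht).const_mul (1 + k))) ?_
      ring
    · rw [hI0]
      nlinarith
  refine ⟨fun t ht => ⟨hIp t ht, hJp t ht, ?_⟩, ?_⟩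
  · rw [div_mul_eq_mul_div, div_lt_iff₀ hd]
    linarith [hD t ht]
  · intro t ht
    have hr : ∀ t, 0 ≤ t → HasDerivAt (fun t => I t / J t)
        (((I t * J t * k - (1 + e) * (I t) ^ 2) * J t - I t * (I t * J t * k - (J t) ^ 2))
          / (J t) ^ 2) t := fun t ht => (hI t ht).fun_div (hJ t ht) (hJp t ht).ne'
    have hanti : StrictAntiOn (fun t => I t / J t) (Set.Ici 0) := by
      apply strictAntiOn_of_deriv_neg (convex_Ici 0)
      · exact fun t ht => (hr t ht).continuousAt.continuousWithinAt
      · intro t ht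
        rw [interior_Ici] at ht
        have ht' : 0 ≤ t := le_of_lt ht
        rw [(hr t ht').deriv]
        have h2 := hJp t ht'
        apply div_neg_of_neg_of_pos _ (by positivity)
        have h3 := mul_pos (mul_pos (hIp t ht') h2) (hD t ht')
        linarith
    have h := hanti (Set.mem_Ici.2 le_rfl) (Set.mem_Ici.2 ht.le) ht
    simp only [hI0] at h
    rw [mul_div_cancel_right₀ _ hJ0.ne', div_lt_iff₀ (hJp t ht.le)] at h
    exact h
end

section
/- Let Δ ∈ (0, π/2) and c > 0 with c·cos Δ > 1, and set ε := c·sin²Δ. Suppose I, J : [0, ∞) → ℝ are differentiable and satisfy I′(t) = I(t)J(t)·cos Δ − (1+ε)·I(t)² and J′(t) = I(t)J(t)·cos Δ − J(t)² for all t ≥ 0, with initial condition J(0) > 0 and I(0) = cos Δ·J(0). Then the ratio I(t)/J(t) converges as t → ∞, with limit (1 + cos Δ)/(1 + cos Δ + ε). -/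
lemma le_init_of_deriv_nonpos (f f' : ℝ → ℝ) (h : ∀ t, 0 ≤ t → HasDerivAt f (f' t) t)
    (hn : ∀ t, 0 ≤ t → f' t ≤ 0) (t : ℝ) (ht : 0 ≤ t) : f t ≤ f 0 := by
  have hanti : AntitoneOn f (Set.Ici 0) := by
    apply antitoneOn_of_deriv_nonpos (convex_Ici 0)
    · exact fun x hx => (h x hx).continuousAt.continuousWithinAt
    · intro x hx
      rw [interior_Ici] at hx
      exact (h x (le_of_lt hx)).differentiableAt.differentiableWithinAt
    · intro x hx
      rw [interior_Ici] at hx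
      rw [(h x (le_of_lt hx)).deriv]
      exact hn x (le_of_lt hx)
  exact hanti (Set.mem_Ici.2 le_rfl) (Set.mem_Ici.2 ht) ht

lemma pos_of_linear (f g : ℝ → ℝ) (h : ∀ t, 0 ≤ t → HasDerivAt f (g t * f t) t)
    (hg : ∀ t, 0 ≤ t → ContinuousAt g t) (h0 : 0 < f 0) (t : ℝ) (ht : 0 ≤ t) : 0 < f t := by
  have hcont : Continuous (fun x => g (max 0 x)) := by
    rw [continuous_iff_continuousAt]
    intro x
    exact ContinuousAt.comp (f := fun x : ℝ => max 0 x) (hg _ (le_max_left 0 x))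
      (by fun_prop)
  have hG : ∀ x, HasDerivAt (fun u => ∫ y in (0:ℝ)..u, g (max 0 y)) (g (max 0 x)) x :=
    fun x => hcont.integral_hasStrictDerivAt 0 x |>.hasDerivAt
  set G : ℝ → ℝ := fun u => ∫ y in (0:ℝ)..u, g (max 0 y) with hGdef
  have key := le_init_of_deriv_nonpos (fun x => -(f x * Real.exp (-G x))) (fun _ => 0)
    (by
      intro x hx
      have h1 := ((h x hx).mul (hG x).neg.exp).neg
      rw [max_eq_right hx] at h1
      refine HasDerivAt.congr_deriv h1 ?_
      simp only [Pi.neg_apply]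
      ring) (fun _ _ => le_rfl) t ht
  have h2 : 0 < f 0 * Real.exp (-G 0) := by positivity
  have h3 : 0 < f t * Real.exp (-G t) := by linarith
  exact (pos_iff_pos_of_mul_pos h3).2 (Real.exp_pos _)

/-- For the Phase IV system `I' = IJ cos Δ - (1+ε)I²`, `J' = IJ cos Δ - J²` with
`J(0) > 0` and `I(0) = cos Δ · J(0)`, the ratio `I(t)/J(t)` converges as `t → ∞`
to `(1 + cos Δ)/(1 + cos Δ + ε)`, where `ε = c sin²Δ`. -/
theorem stmt14 (Δ c : ℝ) (hΔ : Δ ∈ Set.Ioo 0 (Real.pi / 2)) (hc : 0 < c)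
    (hccos : 1 < c * Real.cos Δ)
    (I J : ℝ → ℝ)
    (hI : ∀ t, 0 ≤ t →
      HasDerivAt I
        (I t * J t * Real.cos Δ - (1 + c * Real.sin Δ ^ 2) * (I t) ^ 2) t)
    (hJ : ∀ t, 0 ≤ t →
      HasDerivAt J (I t * J t * Real.cos Δ - (J t) ^ 2) t)
    (hJ0 : 0 < J 0) (hI0 : I 0 = Real.cos Δ * J 0) :
    Filter.Tendsto (fun t => I t / J t) Filter.atTop
      (nhds ((1 + Real.cos Δ) / (1 + Real.cos Δ + c * Real.sin Δ ^ 2))) := by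
  have hk : 0 < Real.cos Δ := by
    by_contra hneg
    nlinarith
  have he : 0 ≤ c * Real.sin Δ ^ 2 := by positivity
  generalize Real.cos Δ = k at *
  generalize c * Real.sin Δ ^ 2 = e at *
  have hJp : ∀ t, 0 ≤ t → 0 < J t := by
    refine pos_of_linear J (fun t => I t * k - J t) ?_ ?_ hJ0
    · intro t ht
      convert hJ t ht using 1
      ring
    · intro t ht
      exact ((hI t ht).continuousAt.mul continuousAt_const).sub (hJ t ht).continuousAt
  have hIp : ∀ t, 0 ≤ t → 0 < I t := by
    refine pos_of_linear I (fun t => J t * k - (1 + e) * I t) ?_ ?_ (by rw [hI0]; positivity)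
    · intro t ht
      convert hI t ht using 1
      ring
    · intro t ht
      exact ((hJ t ht).continuousAt.mul continuousAt_const).sub
        (continuousAt_const.mul (hI t ht).continuousAt)
  set s := (J 0)⁻¹ with hs
  have hsp : 0 < s := by positivity
  have hlow : ∀ t, 0 ≤ t → 1 ≤ J t * (t + s) := by
    intro t ht
    have h1 := le_init_of_deriv_nonpos (fun x => (J x)⁻¹ - x) (fun x => -(k * I x / J x))
      (by
        intro x hx
        have hx' := hJp x hx
        refine HasDerivAt.congr_deriv (((hJ x hx).fun_inv hx'.ne').sub (hasDerivAt_id x)) ?_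
        field_simp
        ring)
      (by
        intro x hx
        have := hJp x hx
        have := hIp x hx
        have : 0 < k * I x / J x := by positivity
        linarith) t ht
    have hp := hJp t ht
    simp only [sub_zero] at h1
    have h2 : (J t)⁻¹ ≤ t + s := by linarith
    calc (1:ℝ) = J t * (J t)⁻¹ := by field_simp
      _ ≤ _ := by gcongr
  set w : ℝ → ℝ := fun t => J t / I t - (1 + k + e) / (1 + k) with hw
  have hwd : ∀ t, 0 ≤ t → HasDerivAt w (-((1 + k) * J t * w t)) t := by
    intro t ht
    have h1 := hIp t ht
    refine HasDerivAt.congr_deriv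
      (((hJ t ht).fun_div (hI t ht) h1.ne').sub_const ((1 + k + e) / (1 + k))) ?_
    simp only [hw]
    field_simp
    ring
  have hb : ∀ t, 0 ≤ t → w t ^ 2 * (t + s) ≤ w 0 ^ 2 * (0 + s) := by
    refine le_init_of_deriv_nonpos (fun t => w t ^ 2 * (t + s))
      (fun t => w t ^ 2 * (1 - 2 * (1 + k) * (J t * (t + s)))) ?_ ?_
    · intro t ht
      refine HasDerivAt.congr_deriv
        (((hwd t ht).fun_pow 2).mul ((hasDerivAt_id t).add_const s)) ?_
      try simp only [id]
      push_cast
      ring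
    · intro t ht
      have := hlow t ht
      apply mul_nonpos_of_nonneg_of_nonpos (sq_nonneg _)
      nlinarith
  have hw2 : Filter.Tendsto (fun t => w t ^ 2) Filter.atTop (nhds 0) := by
    have hlim : Filter.Tendsto (fun t : ℝ => w 0 ^ 2 * (0 + s) / (t + s)) Filter.atTop (nhds 0) :=
      (Filter.tendsto_atTop_add_const_right _ s Filter.tendsto_id).const_div_atTop _
    refine tendsto_of_tendsto_of_tendsto_of_le_of_le' tendsto_const_nhds hlim
      (Filter.Eventually.of_forall fun t => sq_nonneg _) ?_
    filter_upwards [Filter.eventually_ge_atTop 0] with t ht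
    rw [le_div_iff₀ (by positivity)]
    exact hb t ht
  have hw0 : Filter.Tendsto w Filter.atTop (nhds 0) := by
    have h1 := (Real.continuous_sqrt.tendsto 0).comp hw2
    rw [tendsto_zero_iff_abs_tendsto_zero]
    simpa [Function.comp_def, Real.sqrt_sq_eq_abs] using h1
  have hu : Filter.Tendsto (fun t => J t / I t) Filter.atTop (nhds ((1 + k + e) / (1 + k))) := by
    simpa [hw] using hw0.add_const ((1 + k + e) / (1 + k))
  have := hu.inv₀ (by positivity)
  simpa [inv_div] using this
end

section
/- Let Δ ∈ (0, π/2) and c > 0 with c·cos Δ > 1, and set ε := c·sin²Δ. Suppose I, J : [0, ∞) → ℝ are differentiable and satisfy I′(t) = I(t)J(t)·cos Δ − (1+ε)·I(t)² and J′(t) = I(t)J(t)·cos Δ − J(t)² for all t ≥ 0, with initial condition J(0) > 0 and I(0) = cos Δ·J(0). Then for all t ≥ 0: 1/( 1/(I(0)+J(0)) + (1 + ε − cos Δ)·t ) ≤ I(t) + J(t) ≤ 1/( 1/(I(0)+J(0)) + ((1 − cos Δ)/2)·t ). -/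
/-- Increasing if derivative is nonnegative on `[0, ∞)`. -/
theorem aux_mono_s15 (f f' : ℝ → ℝ) (h : ∀ t, 0 ≤ t → HasDerivAt f (f' t) t)
    (hn : ∀ t, 0 ≤ t → 0 ≤ f' t) : ∀ t, 0 ≤ t → f 0 ≤ f t := by
  intro t ht
  have hm : MonotoneOn f (Set.Ici 0) := by
    apply monotoneOn_of_deriv_nonneg (convex_Ici 0)
    · intro x hx
      exact (h x hx).continuousAt.continuousWithinAt
    · intro x hx
      rw [interior_Ici] at hx
      exact (h x (le_of_lt hx)).differentiableAt.differentiableWithinAt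
    · intro x hx
      rw [interior_Ici] at hx
      rw [(h x (le_of_lt hx)).deriv]
      exact hn x (le_of_lt hx)
  exact hm (Set.mem_Ici.2 le_rfl) (Set.mem_Ici.2 ht) ht

/-- Linear comparison: `f' = a f + b`, `b ≥ 0`. -/
theorem aux_lin (f a b : ℝ → ℝ) (ha : ∀ t, 0 ≤ t → ContinuousAt a t)
    (h : ∀ t, 0 ≤ t → HasDerivAt f (a t * f t + b t) t)
    (hb : ∀ t, 0 ≤ t → 0 ≤ b t) :
    ∀ t, 0 ≤ t → ∃ E : ℝ, 0 < E ∧ f 0 ≤ f t * E := by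
  intro t ht
  have hac : Continuous (fun t => a (max t 0)) := by
    rw [continuous_iff_continuousAt]
    intro x
    exact ContinuousAt.comp (f := fun t : ℝ => max t 0) (g := a) (ha _ (le_max_right _ _))
      (by fun_prop)
  have hA : ∀ x, HasDerivAt (fun x => ∫ s in (0:ℝ)..x, a (max s 0)) (a (max x 0)) x :=
    fun x => hac.integral_hasStrictDerivAt 0 x |>.hasDerivAt
  have := aux_mono_s15 (fun x => f x * Real.exp (-(∫ s in (0:ℝ)..x, a (max s 0))))
    (fun x => b x * Real.exp (-(∫ s in (0:ℝ)..x, a (max s 0))))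
    (by
      intro x hx
      have h1 := (h x hx).mul (hA x).neg.exp
      rw [max_eq_left hx] at h1
      refine HasDerivAt.congr_deriv (f := fun x => f x *
        Real.exp (-(∫ s in (0:ℝ)..x, a (max s 0)))) h1 ?_
      simp only [Pi.neg_apply]
      ring)
    (fun x hx => mul_nonneg (hb x hx) (Real.exp_pos _).le) t ht
  refine ⟨Real.exp (-(∫ s in (0:ℝ)..t, a (max s 0))), Real.exp_pos _, ?_⟩
  simpa using this


/-- Two-sided hyperbolic decay bounds on `I + J` for the Phase IV system
`I' = IJ cos Δ - (1+ε)I²`, `J' = IJ cos Δ - J²` with `J(0) > 0` and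
`I(0) = cos Δ · J(0)`, where `ε = c sin²Δ`. -/
theorem stmt15 (Δ c : ℝ) (hΔ : Δ ∈ Set.Ioo 0 (Real.pi / 2)) (hc : 0 < c)
    (hccos : 1 < c * Real.cos Δ)
    (I J : ℝ → ℝ)
    (hI : ∀ t, 0 ≤ t →
      HasDerivAt I
        (I t * J t * Real.cos Δ - (1 + c * Real.sin Δ ^ 2) * (I t) ^ 2) t)
    (hJ : ∀ t, 0 ≤ t →
      HasDerivAt J (I t * J t * Real.cos Δ - (J t) ^ 2) t)
    (hJ0 : 0 < J 0) (hI0 : I 0 = Real.cos Δ * J 0) :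
    ∀ t, 0 ≤ t →
      1 / (1 / (I 0 + J 0) + (1 + c * Real.sin Δ ^ 2 - Real.cos Δ) * t) ≤ I t + J t ∧
      I t + J t ≤ 1 / (1 / (I 0 + J 0) + ((1 - Real.cos Δ) / 2) * t) := by

  have hk0 : 0 < Real.cos Δ := Real.cos_pos_of_mem_Ioo ⟨by linarith [hΔ.1, Real.pi_pos], hΔ.2⟩
  have hk1 : Real.cos Δ ≤ 1 := Real.cos_le_one Δ
  have hs : 0 ≤ Real.sin Δ ^ 2 := sq_nonneg _
  have hsc : Real.sin Δ ^ 2 = 1 - Real.cos Δ ^ 2 := by linarith [Real.sin_sq_add_cos_sq Δ]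
  have hδ : 0 ≤ (c * Real.sin Δ ^ 2) * Real.cos Δ + Real.cos Δ ^ 2 - 1 := by
    have := mul_nonneg (sub_nonneg.2 hccos.le) hs
    nlinarith
  have hε : 0 ≤ c * Real.sin Δ ^ 2 := mul_nonneg hc.le hs
  generalize c * Real.sin Δ ^ 2 = ε at *
  generalize Real.cos Δ = k at *
  have cI : ∀ t, 0 ≤ t → ContinuousAt I t := fun t ht => (hI t ht).continuousAt
  have cJ : ∀ t, 0 ≤ t → ContinuousAt J t := fun t ht => (hJ t ht).continuousAt
  have hI0' : 0 < I 0 := by rw [hI0]; positivity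
  have pJ : ∀ t, 0 ≤ t → 0 < J t := by
    intro t ht
    obtain ⟨E, hE, h⟩ := aux_lin J (fun t => I t * k - J t) (fun _ => 0)
      (fun t ht => ((cI t ht).mul continuousAt_const).sub (cJ t ht))
      (fun t ht => by convert hJ t ht using 1; ring) (fun _ _ => le_rfl) t ht
    exact pos_of_mul_pos_left (lt_of_lt_of_le hJ0 h) hE.le
  have pI : ∀ t, 0 ≤ t → 0 < I t := by
    intro t ht
    obtain ⟨E, hE, h⟩ := aux_lin I (fun t => J t * k - (1 + ε) * I t) (fun _ => 0)
      (fun t ht => ((cJ t ht).mul continuousAt_const).sub (continuousAt_const.mul (cI t ht)))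
      (fun t ht => by convert hI t ht using 1; ring) (fun _ _ => le_rfl) t ht
    exact pos_of_mul_pos_left (lt_of_lt_of_le hI0' h) hE.le
  have hw : ∀ t, 0 ≤ t → 0 ≤ k * J t - I t := by
    intro t ht
    obtain ⟨E, hE, h⟩ := aux_lin (fun t => k * J t - I t)
      (fun t => (I t * k - J t) - (1 + ε + k) * I t)
      (fun t => (ε * k + k ^ 2 - 1) * (I t * J t))
      (fun t ht => (((cI t ht).mul continuousAt_const).sub (cJ t ht)).sub
        (continuousAt_const.mul (cI t ht)))
      (fun t ht => by
        refine HasDerivAt.congr_deriv (f := fun t => k * J t - I t)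
          (((hJ t ht).const_mul k).sub (hI t ht)) ?_
        ring)
      (fun t ht => mul_nonneg hδ (mul_pos (pI t ht) (pJ t ht)).le) t ht
    have h' : 0 ≤ (k * J t - I t) * E := by
      refine le_trans ?_ h
      simp [hI0]
    exact nonneg_of_mul_nonneg_left h' hE
  have hv : ∀ t, 0 ≤ t → 0 ≤ (1 + ε) * I t - k * J t := by
    intro t ht
    obtain ⟨E, hE, h⟩ := aux_lin (fun t => (1 + ε) * I t - k * J t)
      (fun t => (I t * k - J t) - (1 + ε + k) * I t)
      (fun t => (1 + ε - k ^ 2) * (I t * J t))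
      (fun t ht => (((cI t ht).mul continuousAt_const).sub (cJ t ht)).sub
        (continuousAt_const.mul (cI t ht)))
      (fun t ht => by
        refine HasDerivAt.congr_deriv (f := fun t => (1 + ε) * I t - k * J t)
          (((hI t ht).const_mul (1 + ε)).sub ((hJ t ht).const_mul k)) ?_
        ring)
      (fun t ht => mul_nonneg (by nlinarith) (mul_pos (pI t ht) (pJ t ht)).le) t ht
    have h' : 0 ≤ ((1 + ε) * I t - k * J t) * E := by
      refine le_trans ?_ h
      have : 0 ≤ ε * (k * J 0) := by positivity
      simp only [hI0]
      linarith
    exact nonneg_of_mul_nonneg_left h' hE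
  have pS : ∀ t, 0 ≤ t → 0 < I t + J t := fun t ht => add_pos (pI t ht) (pJ t ht)
  have dS : ∀ t, 0 ≤ t → HasDerivAt (fun t => (I t + J t)⁻¹)
      (-(I t * J t * k - (1 + ε) * I t ^ 2 + (I t * J t * k - J t ^ 2)) / (I t + J t) ^ 2) t :=
    fun t ht => ((hI t ht).add (hJ t ht)).inv (pS t ht).ne'
  intro t ht
  have up := aux_mono_s15 (fun t => (I t + J t)⁻¹ - (1 - k) / 2 * t) _
    (fun t ht => (dS t ht).sub ((hasDerivAt_id t).const_mul ((1 - k) / 2)))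
    (fun t ht => by
      have := pS t ht
      rw [sub_nonneg, le_div_iff₀ (by positivity)]
      have h1 : 0 ≤ (1 + k) / 2 * (I t - J t) ^ 2 := by positivity
      have h2 : 0 ≤ ε * I t ^ 2 := by positivity
      nlinarith) t ht
  have lo := aux_mono_s15 (fun t => (1 + ε - k) * t - (I t + J t)⁻¹) _
    (fun t ht => ((hasDerivAt_id t).const_mul (1 + ε - k)).sub (dS t ht))
    (fun t ht => by
      have := pS t ht
      have hi := pI t ht
      have hj := pJ t ht
      rw [sub_nonneg, div_le_iff₀ (by positivity)]
      have h1 := mul_nonneg (hv t ht) hj.le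
      have h2 : I t ≤ J t := by nlinarith [hw t ht]
      have h3 : 0 ≤ k * (J t ^ 2 - I t ^ 2) := mul_nonneg hk0.le (by nlinarith)
      have h4 : 0 ≤ ε * J t ^ 2 := by positivity
      nlinarith) t ht
  have hSt := pS t ht
  have hS0 := pS 0 le_rfl
  simp only [mul_zero, sub_zero, zero_sub] at up lo
  simp only [one_div]
  have hpos : 0 < (I t + J t)⁻¹ := inv_pos.2 hSt
  have hpos0 : 0 < (I 0 + J 0)⁻¹ := inv_pos.2 hS0
  constructor
  · exact inv_le_of_inv_le₀ hSt (by linarith)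
  · refine (le_inv_comm₀ hSt ?_).2 (by linarith)
    have : 0 ≤ (1 - k) / 2 * t := mul_nonneg (by linarith) ht
    linarith
end

section
/- Let Δ ∈ (0, π/2), ε > 0, and T > 0. Suppose I, J : [0, T] → ℝ are differentiable and satisfy I′(t) = I(t)J(t)·cos Δ − (1+ε)·I(t)², J′(t) = I(t)J(t)·cos Δ − J(t)², with I(t) > 0, J(t) > 0, and (1 + cos Δ + ε)·I(t) > (1 + cos Δ)·J(t) for all t ∈ [0, T]. Setting Z(t) := I(t)/J(t), the following first-integral identity holds for all t ∈ [0, T]: log(J(t)/J(0)) = −(1/(1 + cos Δ))·log(Z(t)/Z(0)) + ((sin²Δ + ε)/((1 + cos Δ + ε)(1 + cos Δ)))·log( ((1 + cos Δ + ε)Z(t) − (1 + cos Δ)) / ((1 + cos Δ + ε)Z(0) − (1 + cos Δ)) ). -/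
/-- First-integral identity of the Phase IV system `I' = IJ cos Δ - (1+ε)I²`,
`J' = IJ cos Δ - J²` in the region `(1 + cos Δ + ε)I > (1 + cos Δ)J`: with `Z = I/J`,
`log(J(t)/J(0)) = -(1/(1+cos Δ)) log(Z(t)/Z(0))
  + ((sin²Δ+ε)/((1+cos Δ+ε)(1+cos Δ))) log(((1+cos Δ+ε)Z(t) - (1+cos Δ))/((1+cos Δ+ε)Z(0) - (1+cos Δ)))`. -/
theorem stmt16 (Δ ε T : ℝ) (hΔ : Δ ∈ Set.Ioo 0 (Real.pi / 2)) (hε : 0 < ε) (hT : 0 < T)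
    (I J : ℝ → ℝ)
    (hI : ∀ t ∈ Set.Icc 0 T,
      HasDerivAt I (I t * J t * Real.cos Δ - (1 + ε) * (I t) ^ 2) t)
    (hJ : ∀ t ∈ Set.Icc 0 T,
      HasDerivAt J (I t * J t * Real.cos Δ - (J t) ^ 2) t)
    (hIpos : ∀ t ∈ Set.Icc 0 T, 0 < I t)
    (hJpos : ∀ t ∈ Set.Icc 0 T, 0 < J t)
    (hreg : ∀ t ∈ Set.Icc 0 T, (1 + Real.cos Δ) * J t < (1 + Real.cos Δ + ε) * I t) :
    ∀ t ∈ Set.Icc 0 T,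
      Real.log (J t / J 0) =
        -(1 / (1 + Real.cos Δ)) * Real.log ((I t / J t) / (I 0 / J 0)) +
        ((Real.sin Δ ^ 2 + ε) / ((1 + Real.cos Δ + ε) * (1 + Real.cos Δ))) *
          Real.log (((1 + Real.cos Δ + ε) * (I t / J t) - (1 + Real.cos Δ)) /
            ((1 + Real.cos Δ + ε) * (I 0 / J 0) - (1 + Real.cos Δ))) := by
  have hc : 0 < Real.cos Δ := Real.cos_pos_of_mem_Ioo ⟨by linarith [hΔ.1, Real.pi_pos], hΔ.2⟩
  have hs : Real.sin Δ ^ 2 = 1 - Real.cos Δ ^ 2 := Real.sin_sq Δ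
  rw [hs]
  generalize Real.cos Δ = c at *
  have hb : 0 < 1 + c := by linarith
  have ha : 0 < 1 + c + ε := by linarith
  have hW : ∀ t ∈ Set.Icc 0 T, 0 < (1 + c + ε) * (I t / J t) - (1 + c) := by
    intro t ht
    have h1 := hreg t ht
    have h2 := hJpos t ht
    have h3 : (1 + c + ε) * (I t / J t) - (1 + c)
        = ((1 + c + ε) * I t - (1 + c) * J t) / J t := by
      field_simp
    rw [h3]
    exact div_pos (by linarith) h2
  have hZ : ∀ t ∈ Set.Icc 0 T, 0 < I t / J t := fun t ht => div_pos (hIpos t ht) (hJpos t ht)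
  have hF : ∀ t ∈ Set.Icc 0 T, HasDerivAt (fun t => Real.log (J t)
      + (1 / (1 + c)) * Real.log (I t / J t)
      - ((1 - c ^ 2 + ε) / ((1 + c + ε) * (1 + c))) *
        Real.log ((1 + c + ε) * (I t / J t) - (1 + c))) 0 t := by
    intro t ht
    have h1 := hIpos t ht
    have h2 := hJpos t ht
    have h3 := hW t ht
    have hz := (hI t ht).div (hJ t ht) h2.ne'
    have hz' : HasDerivAt (fun t => I t / J t)
        (-(I t / J t) * J t * ((1 + c + ε) * (I t / J t) - (1 + c))) t := by
      refine hz.congr_deriv ?_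
      field_simp
      ring
    have hd := (((hJ t ht).log h2.ne').add ((hz'.log (hZ t ht).ne').const_mul (1 / (1 + c)))).sub
      ((((hz'.const_mul (1 + c + ε)).sub_const (1 + c)).log h3.ne').const_mul
        ((1 - c ^ 2 + ε) / ((1 + c + ε) * (1 + c))))
    refine hd.congr_deriv ?_
    have hI' : I t = (I t / J t) * J t := by field_simp
    have hzp := hZ t ht
    generalize I t / J t = z at *
    rw [hI']
    have e1 : (1 + c + ε) * (-z * J t * ((1 + c + ε) * z - (1 + c))) / ((1 + c + ε) * z - (1 + c))
        = (1 + c + ε) * (-z * J t) := by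
      rw [← mul_assoc, mul_div_assoc, div_self h3.ne', mul_one]
    rw [e1]
    field_simp
    ring
  intro t ht
  have h0 : (0 : ℝ) ∈ Set.Icc 0 T := ⟨le_rfl, hT.le⟩
  have key := constant_of_has_deriv_right_zero
    (fun x hx => (hF x hx).continuousAt.continuousWithinAt)
    (fun x hx => (hF x ⟨hx.1, hx.2.le⟩).hasDerivWithinAt) t ht
  rw [Real.log_div (hJpos t ht).ne' (hJpos 0 h0).ne', Real.log_div (hZ t ht).ne' (hZ 0 h0).ne',
    Real.log_div (hW t ht).ne' (hW 0 h0).ne']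
  linear_combination key
end

section
/- Let x₊, x₋ be unit vectors in a real inner product space with ⟨x₊, x₋⟩ = cos Δ for some Δ ∈ (0, π/2), let m₊, m₋ be positive reals with m₋ < m₊·cos Δ, and let C > 0. Define β := m₊·sin²Δ/(m₋·(1 + cos Δ)), v₊ := C·(x₊ − cos Δ·x₋), and v₋ := C·((1+β)·x₋ − x₊). Define the two-neuron ReLU output N(x) := m₊·σ(⟨v₊, x⟩) − m₋·σ(⟨v₋, x⟩), where σ(z) = max(z, 0). Then N(x₊) = −N(x₋) = C·( m₋·(1 − cos Δ) + m₊·sin²Δ/(1 + cos Δ) ) > 0. -/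
open scoped RealInnerProductSpace

/-- Margin identity at the limiting direction: for the two-neuron ReLU network
`N(x) = m₊ σ(⟪v₊, x⟫) - m₋ σ(⟪v₋, x⟫)` built from the limiting neuron directions
`v₊ = C(x₊ - cos Δ · x₋)` and `v₋ = C((1+β)x₋ - x₊)` with
`β = m₊ sin²Δ/(m₋(1+cos Δ))`, one has
`N(x₊) = -N(x₋) = C(m₋(1 - cos Δ) + m₊ sin²Δ/(1+cos Δ)) > 0`. -/
theorem stmt17 {E : Type*} [NormedAddCommGroup E] [InnerProductSpace ℝ E]
    (xp xm : E) (Δ mp mm C : ℝ)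
    (hΔ : Δ ∈ Set.Ioo 0 (Real.pi / 2)) (hxp : ‖xp‖ = 1) (hxm : ‖xm‖ = 1)
    (hangle : ⟪xp, xm⟫ = Real.cos Δ)
    (hmp : 0 < mp) (hmm : 0 < mm) (hlt : mm < mp * Real.cos Δ) (hC : 0 < C) :
    let β := mp * Real.sin Δ ^ 2 / (mm * (1 + Real.cos Δ))
    let vp := C • (xp - Real.cos Δ • xm)
    let vm := C • ((1 + β) • xm - xp)
    let N := fun x => mp * max ⟪vp, x⟫ 0 - mm * max ⟪vm, x⟫ 0
    N xp = C * (mm * (1 - Real.cos Δ) + mp * Real.sin Δ ^ 2 / (1 + Real.cos Δ)) ∧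
    N xm = -(C * (mm * (1 - Real.cos Δ) + mp * Real.sin Δ ^ 2 / (1 + Real.cos Δ))) ∧
    0 < C * (mm * (1 - Real.cos Δ) + mp * Real.sin Δ ^ 2 / (1 + Real.cos Δ)) := by
  intro β vp vm N
  have hc0 : 0 < Real.cos Δ :=
    Real.cos_pos_of_mem_Ioo ⟨by linarith [hΔ.1, Real.pi_pos], hΔ.2⟩
  have hs0 : 0 < Real.sin Δ := Real.sin_pos_of_pos_of_lt_pi hΔ.1 (by linarith [hΔ.2, Real.pi_pos])
  have hs : Real.sin Δ ^ 2 = (1 - Real.cos Δ) * (1 + Real.cos Δ) := by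
    have := Real.sin_sq_add_cos_sq Δ
    linarith
  have hangle' : ⟪xm, xp⟫ = Real.cos Δ := by rw [real_inner_comm]; exact hangle
  have hpp : ⟪xp, xp⟫ = (1 : ℝ) := by rw [real_inner_self_eq_norm_sq, hxp]; norm_num
  have hmm' : ⟪xm, xm⟫ = (1 : ℝ) := by rw [real_inner_self_eq_norm_sq, hxm]; norm_num
  have hβ : mm * β = mp * (1 - Real.cos Δ) := by
    simp only [β, hs]
    field_simp
  have hq : mp * Real.sin Δ ^ 2 / (1 + Real.cos Δ) = mp * (1 - Real.cos Δ) := by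
    rw [hs]
    field_simp
  have hc1 : 0 < 1 - Real.cos Δ := by
    have h2 : 0 < (1 - Real.cos Δ) * (1 + Real.cos Δ) := by rw [← hs]; positivity
    exact pos_of_mul_pos_left h2 (by linarith)
  have h1 : ⟪vp, xp⟫ = C * (1 - Real.cos Δ * Real.cos Δ) := by
    simp only [vp, real_inner_smul_left, inner_sub_left, hpp, hangle']
  have h2 : ⟪vp, xm⟫ = (0 : ℝ) := by
    simp only [vp, real_inner_smul_left, inner_sub_left, hmm', hangle]
    ring
  have h3 : ⟪vm, xp⟫ = C * ((1 + β) * Real.cos Δ - 1) := by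
    simp only [vm, real_inner_smul_left, inner_sub_left, hpp, hangle']
  have h4 : ⟪vm, xm⟫ = C * ((1 + β) - Real.cos Δ) := by
    simp only [vm, real_inner_smul_left, inner_sub_left, hmm', hangle]
    ring
  have hβ0 : 0 < β := by
    have : 0 < mm * β := by rw [hβ]; positivity
    exact pos_of_mul_pos_right this hmm.le
  have p1 : 0 ≤ C * (1 - Real.cos Δ * Real.cos Δ) := by
    apply mul_nonneg hC.le
    nlinarith
  have p3 : 0 ≤ C * ((1 + β) * Real.cos Δ - 1) := by
    apply mul_nonneg hC.le
    have e : mm * ((1 + β) * Real.cos Δ - 1) = (1 - Real.cos Δ) * (mp * Real.cos Δ - mm) := by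
      linear_combination Real.cos Δ * hβ
    have : 0 < mm * ((1 + β) * Real.cos Δ - 1) := by
      rw [e]; exact mul_pos hc1 (by linarith)
    exact (pos_of_mul_pos_right this hmm.le).le
  have p4 : 0 ≤ C * ((1 + β) - Real.cos Δ) := mul_nonneg hC.le (by linarith)
  rw [hq]
  refine ⟨?_, ?_, by positivity⟩
  · simp only [N]
    rw [h1, h3, max_eq_left p1, max_eq_left p3]
    linear_combination (-C * Real.cos Δ) * hβ
  · simp only [N]
    rw [h2, h4, max_self, max_eq_left p4]
    linear_combination (-C) * hβ
end

section
/- Let x₊, x₋ be unit vectors in a real inner product space with ⟨x₊, x₋⟩ = cos Δ for some Δ ∈ (0, π/2), let m₊, m₋ be positive reals, and let Q > 0. Define β := m₊·sin²Δ/(m₋·(1 + cos Δ)), and for ε ∈ ℝ define b₊(ε) := Q·(1−ε)·(x₊ − cos Δ·x₋) and b₋(ε) := Q·((1+β)·x₋ − x₊) + Q·ε·(x₊ − cos Δ·x₋). Then: (i) ⟨b₊(ε), x₋⟩ = 0 and ⟨b₋(ε), x₋⟩ = ⟨b₋(0), x₋⟩ for every ε ∈ ℝ; (ii) the function φ(ε)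 := m₊·‖b₊(ε)‖² + m₋·‖b₋(ε)‖² is differentiable with φ′(0) = −2·(m₊ + m₋)·Q²·sin²Δ < 0; and (iii) consequently there exists δ > 0 such that φ(ε) < φ(0) for all ε ∈ (0, δ). -/
open scoped RealInnerProductSpace

/-- The limiting configuration is not a local optimum of the max-margin problem:
the explicit perturbation `b₊(ε), b₋(ε)` keeps all inner products with `x₋` fixed,
while the total squared norm `φ(ε) = m₊‖b₊(ε)‖² + m₋‖b₋(ε)‖²` has strictly negative
derivative `-2(m₊+m₋)Q² sin²Δ` at `ε = 0`, hence strictly decreases for small `ε > 0`. -/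
theorem stmt18 {E : Type*} [NormedAddCommGroup E] [InnerProductSpace ℝ E]
    (xp xm : E) (Δ mp mm Q : ℝ)
    (hΔ : Δ ∈ Set.Ioo 0 (Real.pi / 2)) (hxp : ‖xp‖ = 1) (hxm : ‖xm‖ = 1)
    (hangle : ⟪xp, xm⟫ = Real.cos Δ)
    (hmp : 0 < mp) (hmm : 0 < mm) (hQ : 0 < Q) :
    let β := mp * Real.sin Δ ^ 2 / (mm * (1 + Real.cos Δ))
    let bp := fun ε : ℝ => (Q * (1 - ε)) • (xp - Real.cos Δ • xm)
    let bm := fun ε : ℝ =>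
      Q • ((1 + β) • xm - xp) + (Q * ε) • (xp - Real.cos Δ • xm)
    let φ := fun ε : ℝ => mp * ‖bp ε‖ ^ 2 + mm * ‖bm ε‖ ^ 2
    (∀ ε : ℝ, ⟪bp ε, xm⟫ = 0 ∧ ⟪bm ε, xm⟫ = ⟪bm 0, xm⟫) ∧
    HasDerivAt φ (-2 * (mp + mm) * Q ^ 2 * Real.sin Δ ^ 2) 0 ∧
    -2 * (mp + mm) * Q ^ 2 * Real.sin Δ ^ 2 < 0 ∧
    ∃ δ > 0, ∀ ε ∈ Set.Ioo (0 : ℝ) δ, φ ε < φ 0 := by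
  intro β bp bm φ
  have hs : 0 < Real.sin Δ :=
    Real.sin_pos_of_pos_of_lt_pi hΔ.1 (by linarith [hΔ.2, Real.pi_pos])
  have hsc := Real.sin_sq_add_cos_sq Δ
  have hpp : ⟪xp, xp⟫ = 1 := by rw [real_inner_self_eq_norm_sq, hxp]; norm_num
  have hmm1 : ⟪xm, xm⟫ = 1 := by rw [real_inner_self_eq_norm_sq, hxm]; norm_num
  have hvm : ⟪xp - Real.cos Δ • xm, xm⟫ = 0 := by
    rw [inner_sub_left, real_inner_smul_left, hangle, hmm1]; ring
  have hvp : ⟪xp - Real.cos Δ • xm, xp⟫ = Real.sin Δ ^ 2 := by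
    rw [inner_sub_left, real_inner_smul_left, real_inner_comm, hpp, real_inner_comm, hangle]
    linarith
  have hvv : ‖xp - Real.cos Δ • xm‖ ^ 2 = Real.sin Δ ^ 2 := by
    rw [← real_inner_self_eq_norm_sq, inner_sub_right, real_inner_smul_right, hvp, hvm]; ring
  have huv : ⟪(1 + β) • xm - xp, xp - Real.cos Δ • xm⟫ = - Real.sin Δ ^ 2 := by
    rw [real_inner_comm, inner_sub_right, real_inner_smul_right, hvp, hvm]; ring
  have hφ : ∀ ε, φ ε = mp * (Q ^ 2 * (1 - ε) ^ 2 * Real.sin Δ ^ 2) +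
      mm * (Q ^ 2 * ‖(1 + β) • xm - xp‖ ^ 2 - 2 * Q ^ 2 * ε * Real.sin Δ ^ 2
        + Q ^ 2 * ε ^ 2 * Real.sin Δ ^ 2) := by
    intro ε
    simp only [φ, bp, bm]
    rw [norm_add_sq_real, norm_smul, norm_smul, norm_smul, mul_pow, mul_pow, mul_pow, hvv,
      real_inner_smul_left, real_inner_smul_right, huv]
    simp only [Real.norm_eq_abs, sq_abs]
    ring
  have hK : 0 < (mp + mm) * Q ^ 2 * Real.sin Δ ^ 2 := by positivity
  have hφ' : ∀ ε, φ ε = φ 0 + ((mp + mm) * Q ^ 2 * Real.sin Δ ^ 2) * (ε ^ 2 - 2 * ε) := by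
    intro ε
    rw [hφ ε, hφ 0]; ring
  refine ⟨fun ε => ⟨?_, ?_⟩, ?_, by linarith, 2, by norm_num, ?_⟩
  · simp only [bp]
    rw [real_inner_smul_left, hvm, mul_zero]
  · simp only [bm]
    rw [inner_add_left, inner_add_left, real_inner_smul_left (xp - _), hvm,
      real_inner_smul_left (xp - _), hvm]
    simp
  · rw [funext hφ']
    have h := ((((hasDerivAt_id (0 : ℝ)).pow 2).sub
      ((hasDerivAt_id (0 : ℝ)).const_mul 2)).const_mul
      ((mp + mm) * Q ^ 2 * Real.sin Δ ^ 2)).const_add (φ 0)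
    refine HasDerivAt.congr_deriv (f := fun ε : ℝ => φ 0 +
      ((mp + mm) * Q ^ 2 * Real.sin Δ ^ 2) * (ε ^ 2 - 2 * ε)) h ?_
    norm_num
    ring
  · intro ε hε
    rw [hφ' ε]
    nlinarith [mul_pos hK (mul_pos hε.1 (sub_pos.2 hε.2))]
end

section
/- Let A > 0, B > 0, C₁ > 0, C₂ > 0 with C₁ ≠ B, and E₀ ∈ ℝ. Define E(t) := (1 + B·t/A)^{−C₁/B}·( E₀ − (C₂/(A·(C₁ − B)))·((1 + B·t/A)^{C₁/B − 1} − 1) ) for t ≥ 0. Then E(0) = E₀ and E is differentiable on [0, ∞) with E′(t) = −C₁·E(t)/(A + B·t) − C₂/(A + B·t)² for all t ≥ 0. Moreover, if C₁ > B and E₀ > 0, then setting T := (A/B)·( (1 + A·(C₁ − B)·E₀/C₂)^{B/(C₁ − B)} − 1 ), one has E(t) > 0 for t ∈ [0, T), E(T) = 0, and E(t) < 0 for t > T. -/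
/-- Explicit solution of the linear ODE `E' = -C₁E/(A+Bt) - C₂/(A+Bt)²`:
the function `E(t) = (1+Bt/A)^{-C₁/B}(E₀ - (C₂/(A(C₁-B)))((1+Bt/A)^{C₁/B-1} - 1))`
satisfies `E(0) = E₀` and the ODE for `t ≥ 0`; moreover, if `C₁ > B` and `E₀ > 0`,
then `E` vanishes exactly at `T = (A/B)((1 + A(C₁-B)E₀/C₂)^{B/(C₁-B)} - 1)`,
being positive on `[0, T)` and negative on `(T, ∞)`. -/
theorem stmt19 (A B C₁ C₂ E₀ : ℝ) (hA : 0 < A) (hB : 0 < B) (hC₁ : 0 < C₁)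
    (hC₂ : 0 < C₂) (hne : C₁ ≠ B) :
    let E := fun t : ℝ => (1 + B * t / A) ^ (-(C₁ / B)) *
      (E₀ - C₂ / (A * (C₁ - B)) * ((1 + B * t / A) ^ (C₁ / B - 1) - 1))
    E 0 = E₀ ∧
    (∀ t : ℝ, 0 ≤ t →
      HasDerivAt E (-C₁ * E t / (A + B * t) - C₂ / (A + B * t) ^ 2) t) ∧
    (B < C₁ → 0 < E₀ →
      let T := A / B * ((1 + A * (C₁ - B) * E₀ / C₂) ^ (B / (C₁ - B)) - 1)
      (∀ t, 0 ≤ t → t < T → 0 < E t) ∧ E T = 0 ∧ (∀ t, T < t → E t < 0)) := by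
  intro E
  have hD : C₁ - B ≠ 0 := sub_ne_zero.mpr hne
  refine ⟨?_, ?_, ?_⟩
  · simp [E]
  · intro t ht
    have hx : 0 < 1 + B * t / A := by positivity
    have hlin : HasDerivAt (fun t : ℝ => 1 + B * t / A) (B / A) t := by
      have h := (((hasDerivAt_id t).const_mul B).div_const A).const_add 1
      simpa using h
    have hP := hlin.rpow_const (p := -(C₁ / B)) (Or.inl hx.ne')
    have hQ := hlin.rpow_const (p := C₁ / B - 1) (Or.inl hx.ne')
    have h := hP.mul (((hQ.sub_const 1).const_mul (C₂ / (A * (C₁ - B)))).const_sub E₀)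
    refine h.congr_deriv ?_
    have hAx : A + B * t = A * (1 + B * t / A) := by field_simp
    have hPQ : (1 + B * t / A) ^ (-(C₁ / B)) * (1 + B * t / A) ^ (C₁ / B - 1)
        = (1 + B * t / A)⁻¹ := by
      rw [← Real.rpow_add hx, ← Real.rpow_neg_one]
      congr 1
      ring
    simp only [E]
    rw [Real.rpow_sub_one hx.ne' (-(C₁ / B)), Real.rpow_sub_one hx.ne' (C₁ / B - 1), hAx]
    generalize (1 + B * t / A) ^ (-(C₁ / B)) = P at *
    generalize (1 + B * t / A) ^ (C₁ / B - 1) = Q at *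
    generalize (1 + B * t / A) = x at *
    have e1 : C₂ / (A * x) ^ 2 = C₂ / (A ^ 2 * x) * (P * Q) := by
      rw [hPQ]; field_simp
    rw [e1]
    field_simp
    ring
  · intro hlt hE T
    have hd : 0 < C₁ - B := sub_pos.mpr hlt
    have hM : 1 < 1 + A * (C₁ - B) * E₀ / C₂ := by
      have : 0 < A * (C₁ - B) * E₀ / C₂ := by positivity
      linarith
    have hp : 0 < C₁ / B - 1 := by
      rw [sub_pos, one_lt_div hB]; exact hlt
    have hq : 0 < B / (C₁ - B) := by positivity
    have hxT : 1 + B * T / A = (1 + A * (C₁ - B) * E₀ / C₂) ^ (B / (C₁ - B)) := by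
      simp only [T]
      field_simp
      ring
    have hx1 : 1 < 1 + B * T / A := by
      rw [hxT]; exact Real.one_lt_rpow hM hq
    have hQT : (1 + B * T / A) ^ (C₁ / B - 1) = 1 + A * (C₁ - B) * E₀ / C₂ := by
      rw [hxT, ← Real.rpow_mul (by linarith)]
      have : B / (C₁ - B) * (C₁ / B - 1) = 1 := by field_simp
      rw [this, Real.rpow_one]
    have hK : 0 < C₂ / (A * (C₁ - B)) := by positivity
    have hEt : ∀ t, E t = (1 + B * t / A) ^ (-(C₁ / B)) * (C₂ / (A * (C₁ - B)) *
        ((1 + B * T / A) ^ (C₁ / B - 1) - (1 + B * t / A) ^ (C₁ / B - 1))) := by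
      intro t
      rw [hQT]
      simp only [E]
      congr 1
      field_simp
      ring
    have hmono : ∀ s t : ℝ, s < t → 1 + B * s / A < 1 + B * t / A := by
      intro s t hst
      gcongr
    refine ⟨?_, ?_, ?_⟩
    · intro t ht htT
      have hx : 0 < 1 + B * t / A := by positivity
      rw [hEt]
      exact mul_pos (Real.rpow_pos_of_pos hx _) (mul_pos hK
        (sub_pos.mpr (Real.rpow_lt_rpow hx.le (hmono _ _ htT) hp)))
    · rw [hEt]; simp
    · intro t htT
      have hx : 0 < 1 + B * t / A := by linarith [hmono _ _ htT]
      rw [hEt]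
      exact mul_neg_of_pos_of_neg (Real.rpow_pos_of_pos hx _) (mul_neg_of_pos_of_neg hK
        (sub_neg.mpr (Real.rpow_lt_rpow (by linarith) (hmono _ _ htT) hp)))
end
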